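/- arXiv:2103.04577 — 3 statements merged into one kernel-verified Lean document; each statement's English description precedes it below -/
import Mathlib

section
/- A 3×3 nonnegative matrix A is similar over the reals to a nonnegative upper Hessenberg matrix if and only if A does not have a negative eigenvalue of geometric multiplicity 2. -/
open Matrix

/-- Perron root of a two by two block. -/
lemma perron_two (a b d e : ℝ) (hb : 0 ≤ b) (hd : 0 ≤ d) :
    ∃ m, a ≤ m ∧ e ≤ m ∧ (m - a) * (m - e) = b * d := by
  have hbd := mul_nonneg hb hd
  have h0 : 0 ≤ (a - e)^2 + 4 * (b * d) := by positivity
  have hs := Real.sq_sqrt h0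
  have h1 : |a - e| ≤ √((a - e)^2 + 4 * (b * d)) := by
    rw [← Real.sqrt_sq_eq_abs]; exact Real.sqrt_le_sqrt (by linarith)
  have h2 := abs_le.mp h1
  exact ⟨(a + e + √((a - e)^2 + 4 * (b * d))) / 2, by linarith, by linarith, by nlinarith⟩

/-- scalar characteristic polynomial -/
noncomputable def cp (a b c d e f g h i x : ℝ) : ℝ :=
  (x - a) * (x - e) * (x - i) - b * f * g - c * d * h - c * g * (x - e) - b * d * (x - i)
    - f * h * (x - a)

lemma cp_nonpos {a b c d e f g h i m : ℝ} (hb : 0 ≤ b) (hc : 0 ≤ c) (hd : 0 ≤ d) (hf : 0 ≤ f)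
    (hg : 0 ≤ g) (hh : 0 ≤ h) (ha : a ≤ m) (he : e ≤ m) (hm : (m - a) * (m - e) = b * d) :
    cp a b c d e f g h i m ≤ 0 := by
  have h1 : cp a b c d e f g h i m = ((m - a) * (m - e) - b * d) * (m - i)
    - (b * f * g + c * d * h + c * g * (m - e) + f * h * (m - a)) := by unfold cp; ring
  rw [h1, hm]
  have : 0 ≤ m - a := by linarith
  have : 0 ≤ m - e := by linarith
  have : 0 ≤ b * f * g + c * d * h + c * g * (m - e) + f * h * (m - a) := by positivity
  linarith

lemma cp_rot (a b c d e f g h i x : ℝ) : cp a b c d e f g h i x = cp e f d h i g b c a x := by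
  unfold cp; ring

lemma minor_bound {a b c d e f g h i r : ℝ} (ha : 0 ≤ a) (he : 0 ≤ e)
    (hb : 0 ≤ b) (hc : 0 ≤ c) (hd : 0 ≤ d) (hf : 0 ≤ f)
    (hg : 0 ≤ g) (hh : 0 ≤ h) (hr : ∀ m, r ≤ m → 0 < cp a b c d e f g h i m) :
    b * d ≤ r ^ 2 := by
  obtain ⟨m, h1, h2, h3⟩ := perron_two a b d e hb hd
  have h4 := cp_nonpos (i := i) hb hc hd hf hg hh h1 h2 h3
  have h5 : m < r := by
    by_contra hx
    exact absurd (hr m (not_lt.mp hx)) (not_lt.mpr h4)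
  rw [← h3]
  nlinarith

lemma dominate {a b c d e f g h i x y z : ℝ} (ha : 0 ≤ a) (he : 0 ≤ e) (hi : 0 ≤ i)
    (hb : 0 ≤ b) (hc : 0 ≤ c) (hd : 0 ≤ d) (hf : 0 ≤ f)
    (hg : 0 ≤ g) (hh : 0 ≤ h)
    (hP : ∀ t, cp a b c d e f g h i t = (t - x) * (t - y) * (t - z))
    (hz : z < 0) (hyx : y ≤ x) : 0 ≤ x + z := by
  by_contra hx
  have hpos : ∀ m, -z ≤ m → 0 < cp a b c d e f g h i m := by
    intro m hm
    rw [hP]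
    have : 0 < m - x := by linarith
    have : 0 < m - y := by linarith
    have : 0 < m - z := by linarith
    positivity
  have m1 := minor_bound ha he hb hc hd hf hg hh hpos
  have m2 := minor_bound he hi hf hd hh hg hb hc (fun m hm => by
    rw [← cp_rot]; exact hpos m hm)
  have m3 := minor_bound hi ha hg hh hc hb hf hd (fun m hm => by
    rw [← cp_rot, ← cp_rot]; exact hpos m hm)
  have p1 := hpos (-z) le_rfl
  have p2 := hP z
  have e1 : cp a b c d e f g h i (-z) = -2 * ((-z)^2 * (a + e + i) + (a*e*i + b*f*g + c*d*h
      - c*e*g - b*d*i - a*f*h)) + (- cp a b c d e f g h i z) := by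
    unfold cp; ring
  rw [e1, p2] at p1
  have q1 := mul_le_mul_of_nonneg_left m1 hi
  have q2 := mul_le_mul_of_nonneg_left m2 ha
  have q3 := mul_le_mul_of_nonneg_left m3 he
  have : 0 ≤ a*e*i := by positivity
  have : 0 ≤ b*f*g := by positivity
  have : 0 ≤ c*d*h := by positivity
  nlinarith

/-- Existence of `m ≥ trace/3` with nonpositive characteristic polynomial value. -/
lemma exists_m {a b c d e f g h i t : ℝ}
    (hb : 0 ≤ b) (hc : 0 ≤ c) (hd : 0 ≤ d) (hf : 0 ≤ f)
    (hg : 0 ≤ g) (hh : 0 ≤ h) (ht : 3 * t = a + e + i) :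
    ∃ m, t ≤ m ∧ cp a b c d e f g h i m ≤ 0 := by
  obtain ⟨m, h1, h2, h3⟩ := perron_two a b d e hb hd
  obtain ⟨n, k1, k2, k3⟩ := perron_two e f h i hf hh
  have h4 := cp_nonpos (i := i) hb hc hd hf hg hh h1 h2 h3
  have k4 := cp_nonpos (i := a) hf hd hh hg hb hc k1 k2 k3
  rw [← cp_rot] at k4
  by_cases hm : t ≤ m
  · exact ⟨m, hm, h4⟩
  · exact ⟨n, by linarith, k4⟩

/-- real factorization when the shifted determinant is negative -/
lemma factor_real {p q s : ℝ} (hq : q < 0) (hs : 0 ≤ s) (hsf : s ^ 3 - p * s - q ≤ 0) :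
    ∃ x y z, z < 0 ∧ 0 < y ∧ y ≤ x ∧ x + y + z = 0 ∧ x * y + y * z + z * x = -p ∧
      x * y * z = q := by
  have hcont : Continuous (fun x : ℝ => x ^ 3 - p * x - q) := by fun_prop
  obtain ⟨β, hβ, hβ0⟩ := intermediate_value_Icc' hs hcont.continuousOn
    (show (0 : ℝ) ∈ Set.Icc _ _ from ⟨hsf, by simp; linarith⟩)
  have hL : (0 : ℝ) < 1 + |p| + |q| := by positivity
  obtain ⟨α, hα, hα0⟩ := intermediate_value_Icc (show -(1 + |p| + |q|) ≤ 0 by linarith)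
    hcont.continuousOn
    (show (0 : ℝ) ∈ Set.Icc _ _ from ⟨by
      have := le_abs_self p
      have := neg_abs_le q
      have := abs_nonneg p
      have := abs_nonneg q
      have h1 : p * (1 + |p| + |q|) ≤ |p| * (1 + |p| + |q|) := by gcongr
      have h2 : 0 ≤ |p| * |q| := by positivity
      have h3 : (1 + |p| + |q|) * (1+|p|) ≤ (1 + |p| + |q|) ^ 3 := by
        rw [show (1 + |p| + |q|) ^ 3 = (1 + |p| + |q|) * (1 + |p| + |q|)^2 by ring]
        gcongr
        nlinarith
      nlinarith, by simp; linarith⟩)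
  simp only at hα0 hβ0
  have hβ1 : 0 < β := lt_of_le_of_ne hβ.1 (by rintro rfl; simp at hβ0; linarith)
  have hα1 : α < 0 := lt_of_le_of_ne hα.2 (by rintro rfl; simp at hα0; linarith)
  have hp : α^2 + α * β + β^2 = p := by
    have : (α - β) * (α^2 + α * β + β^2 - p) = 0 := by linear_combination hα0 - hβ0
    rcases mul_eq_zero.mp this with h | h <;> linarith
  have hq' : q = α * β * (-α - β) := by
    rw [← hp] at hα0
    linear_combination - hα0
  have hγ : 0 < -α - β := by
    by_contra hx
    have : 0 ≤ (-α) * β * (-(-α-β)) := by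
      have : 0 ≤ -α := by linarith
      have : 0 ≤ -(-α-β) := by linarith
      positivity
    linarith
  rcases le_total β (-α-β) with h | h
  · exact ⟨-α-β, β, α, hα1, hβ1, h, by ring, by rw [← hp]; ring, by rw [hq']; ring⟩
  · exact ⟨β, -α-β, α, hα1, hγ, h, by ring, by rw [← hp]; ring, by rw [hq']; ring⟩

/-- Similar to a nonnegative Hessenberg matrix. -/
def HessSim (A : Matrix (Fin 3) (Fin 3) ℝ) : Prop :=
  ∃ (B T : Matrix (Fin 3) (Fin 3) ℝ), T.det ≠ 0 ∧ A * T = T * B ∧ (∀ i j, 0 ≤ B i j) ∧ B 2 0 = 0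

lemma HessSim.trans {A C K : Matrix (Fin 3) (Fin 3) ℝ} (hK : K.det ≠ 0) (h : A * K = K * C)
    (hC : HessSim C) : HessSim A := by
  obtain ⟨B, T, h1, h2, h3, h4⟩ := hC
  refine ⟨B, K * T, by rw [det_mul]; exact mul_ne_zero hK h1, ?_, h3, h4⟩
  rw [← mul_assoc, h, mul_assoc, h2, mul_assoc]

lemma det_sim {A C K : Matrix (Fin 3) (Fin 3) ℝ} (hK : K.det ≠ 0) (h : A * K = K * C) (x : ℝ) :
    (x • (1 : Matrix (Fin 3) (Fin 3) ℝ) - A).det = (x • (1 : Matrix (Fin 3) (Fin 3) ℝ) - C).det := by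
  have : (x • (1 : Matrix (Fin 3) (Fin 3) ℝ) - A) * K = K * (x • 1 - C) := by
    rw [sub_mul, mul_sub, h]; simp
  have h2 := congrArg det this
  rw [det_mul, det_mul, mul_comm] at h2
  exact mul_left_cancel₀ hK h2

lemma det_cp (a b c d e f g h i x : ℝ) :
    (x • (1 : Matrix (Fin 3) (Fin 3) ℝ) - !![a,b,c;d,e,f;g,h,i]).det = cp a b c d e f g h i x := by
  simp [det_fin_three, cp]
  ring

/-- Krylov matrix -/
def kry (A : Matrix (Fin 3) (Fin 3) ℝ) (v : Fin 3 → ℝ) : Matrix (Fin 3) (Fin 3) ℝ :=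
  (Matrix.of ![v, A *ᵥ v, A *ᵥ (A *ᵥ v)])ᵀ

lemma kry_sim {A C K : Matrix (Fin 3) (Fin 3) ℝ} (h : A * K = K * C) (y : Fin 3 → ℝ) :
    kry A (K *ᵥ y) = K * kry C y := by
  have h1 : A *ᵥ (K *ᵥ y) = K *ᵥ (C *ᵥ y) := by
    rw [mulVec_mulVec, h, mulVec_mulVec]
  have h2 : A *ᵥ (K *ᵥ (C *ᵥ y)) = K *ᵥ (C *ᵥ (C *ᵥ y)) := by
    rw [mulVec_mulVec, h, mulVec_mulVec]
    simp [mulVec_mulVec, mul_assoc]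
  ext i j
  unfold kry
  rw [h1, h2]
  fin_cases j <;> rfl

lemma kry_companion (a b c d e f g h i : ℝ) (v : Fin 3 → ℝ) :
    !![a,b,c;d,e,f;g,h,i] * kry !![a,b,c;d,e,f;g,h,i] v = kry !![a,b,c;d,e,f;g,h,i] v *
      !![0, 0, a*e*i + b*f*g + c*d*h - c*e*g - b*d*i - a*f*h;
         1, 0, -(a*e+a*i+e*i-b*d-c*g-f*h);
         0, 1, a+e+i] := by
  ext j k
  fin_cases k <;> fin_cases j <;>
    simp [kry, mul_apply, mulVec, dotProduct, Fin.sum_univ_three] <;> ring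

lemma companion_shift {e1 e2 e3 t : ℝ} (ht0 : 0 ≤ t) (ht : 3 * t = e1)
    (hp : 0 ≤ 3 * t ^ 2 - e2) (hq : 0 ≤ e3 - e2 * t + e1 * t ^ 2 - t ^ 3) :
    HessSim !![0, 0, e3; 1, 0, -e2; 0, 1, e1] := by
  refine ⟨!![t, 0, e3 - e2 * t + e1 * t ^ 2 - t ^ 3; 1, t, 3 * t ^ 2 - e2; 0, 1, t],
    !![1, -t, t^2; 0, 1, -2*t; 0, 0, 1], by simp [det_fin_three], ?_, ?_, by simp⟩
  · subst ht
    ext i j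
    fin_cases i <;> fin_cases j <;> simp [mul_apply, Fin.sum_univ_three] <;> ring
  · intro i j
    fin_cases i <;> fin_cases j <;> simp <;> linarith

lemma companion_real_neg {e1 e2 e3 x y z : ℝ} (h1 : e1 = x + y + z)
    (h2 : e2 = x * y + y * z + z * x) (h3 : e3 = x * y * z)
    (hy : 0 ≤ y) (hxz : x * z ≤ 0) (hxz' : 0 ≤ x + z) :
    HessSim !![0, 0, e3; 1, 0, -e2; 0, 1, e1] := by
  refine ⟨!![y, 0, 0; 1, 0, -(x*z); 0, 1, x + z],
    !![1, -y, 0; 0, 1, -y; 0, 0, 1], by simp [det_fin_three], ?_, ?_, by simp⟩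
  · subst h1 h2 h3
    ext i j
    fin_cases i <;> fin_cases j <;> simp [mul_apply, Fin.sum_univ_three] <;> ring
  · intro i j
    fin_cases i <;> fin_cases j <;> simp <;> linarith

lemma companion_real_pos {e1 e2 e3 x y z : ℝ} (h1 : e1 = x + y + z)
    (h2 : e2 = x * y + y * z + z * x) (h3 : e3 = x * y * z)
    (hx : 0 ≤ x) (hy : 0 ≤ y) (hz : 0 ≤ z) :
    HessSim !![0, 0, e3; 1, 0, -e2; 0, 1, e1] := by
  refine ⟨!![x, 0, 0; 1, y, 0; 0, 1, z],
    !![1, -x, x*y; 0, 1, -x-y; 0, 0, 1], by simp [det_fin_three], ?_, ?_, by simp⟩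
  · subst h1 h2 h3
    ext i j
    fin_cases i <;> fin_cases j <;> simp [mul_apply, Fin.sum_univ_three] <;> ring
  · intro i j
    fin_cases i <;> fin_cases j <;> simp <;> linarith

lemma cyclic_case {a b c d e f g h i : ℝ} (ha : 0 ≤ a) (he : 0 ≤ e) (hi : 0 ≤ i)
    (hb : 0 ≤ b) (hc : 0 ≤ c) (hd : 0 ≤ d) (hf : 0 ≤ f)
    (hg : 0 ≤ g) (hh : 0 ≤ h) (v : Fin 3 → ℝ)
    (hv : (kry !![a,b,c;d,e,f;g,h,i] v).det ≠ 0) : HessSim !![a,b,c;d,e,f;g,h,i] := by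
  refine HessSim.trans hv (kry_companion a b c d e f g h i v) ?_
  obtain ⟨t, ht⟩ : ∃ t, 3 * t = a + e + i := ⟨(a + e + i) / 3, by ring⟩
  have ht0 : 0 ≤ t := by linarith
  have hi' : i = 3 * t - a - e := by linarith
  obtain ⟨e2, he2⟩ : ∃ e2, e2 = a*e+a*i+e*i-b*d-c*g-f*h := ⟨_, rfl⟩
  obtain ⟨e3, he3⟩ : ∃ e3, e3 = a*e*i + b*f*g + c*d*h - c*e*g - b*d*i - a*f*h := ⟨_, rfl⟩
  have hcp : ∀ x, cp a b c d e f g h i x = x ^ 3 - 3 * t * x ^ 2 + e2 * x - e3 := by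
    intro x; rw [he2, he3, ht]; unfold cp; ring
  have hp : 0 ≤ 3 * t ^ 2 - e2 := by
    have := mul_nonneg hb hd
    have := mul_nonneg hc hg
    have := mul_nonneg hf hh
    rw [he2]
    nlinarith [sq_nonneg (a - e), sq_nonneg (a - i), sq_nonneg (e - i)]
  rw [← he2, ← he3, ← ht]
  by_cases hq : 0 ≤ e3 - e2 * t + (3 * t) * t ^ 2 - t ^ 3
  · exact companion_shift ht0 rfl hp hq
  · obtain ⟨m, hm1, hm2⟩ := exists_m (c := c) (g := g) hb hc hd hf hg hh ht
    rw [hcp] at hm2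
    obtain ⟨x, y, z, hz, hy, hyx, s1, s2, s3⟩ := factor_real (s := m - t) (p := 3 * t ^ 2 - e2)
      (not_le.mp hq) (by linarith) (by nlinarith)
    have r1 : 3 * t = (x + t) + (y + t) + (z + t) := by linarith
    have r2 : e2 = (x + t) * (y + t) + (y + t) * (z + t) + (z + t) * (x + t) := by
      linear_combination -s2 - 2 * t * s1
    have r3 : e3 = (x + t) * (y + t) * (z + t) := by
      linear_combination -s3 - t * s2 - t ^ 2 * s1
    by_cases hz' : 0 ≤ z + t
    · exact companion_real_pos r1 r2 r3 (by linarith) (by linarith) hz'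
    · refine companion_real_neg r1 r2 r3 (by linarith) ?_ ?_
      · exact mul_nonpos_of_nonneg_of_nonpos (by linarith) (by linarith)
      · refine dominate ha he hi hb hc hd hf hg hh (x := x + t) (y := y + t) (z := z + t) ?_
          (by linarith) (by linarith)
        intro w
        rw [hcp, r2, r3, r1]; ring

/-- The derogatory normal form. -/
lemma derog_conditions {α β γ δ ε : ℝ}
    (h : ∀ y, (kry !![0, α, γ; 1, β, δ; 0, 0, ε] y).det = 0) :
    α = -(ε * (β - ε)) ∧ γ = -(ε * δ) := by
  have key : ∀ s, (-ε * s + γ)^2 + β * (-ε * s + γ) * (s + δ) - α * (s + δ)^2 = 0 := by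
    intro s
    have := h ![s, 0, 1]
    simp [kry, det_fin_three, mulVec, dotProduct, Fin.sum_univ_three] at this
    linear_combination this
  have k0 := key 0
  have k1 := key 1
  have k2 := key (-1)
  have hα : α = -(ε * (β - ε)) := by linear_combination k0 - k1/2 - k2/2
  refine ⟨hα, ?_⟩
  subst hα
  by_contra hne
  have hne' : γ + ε * δ ≠ 0 := fun h => hne (by linarith)
  have q0 : (γ + ε * δ) * (γ + (β - ε) * δ) = 0 := by linear_combination k0
  have q1 : (γ + ε * δ) * (β - ε - ε) = 0 := by linear_combination k1 - k0
  have w0 := (mul_eq_zero.mp q0).resolve_left hne'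
  have w1 := (mul_eq_zero.mp q1).resolve_left hne'
  apply hne'
  linear_combination w0 - δ * w1

lemma derog_form_pos {ε μ δ : ℝ} (hε : 0 ≤ ε) (hμ : 0 ≤ μ) :
    HessSim !![0, -(ε * μ), -(ε * δ); 1, μ + ε, δ; 0, 0, ε] := by
  rcases le_total 0 δ with hδ | hδ
  · refine ⟨!![ε, 0, 0; 1, μ, δ; 0, 0, ε], !![1, -ε, 0; 0, 1, 0; 0, 0, 1],
      by simp [det_fin_three], ?_, ?_, by simp⟩
    · ext i j
      fin_cases i <;> fin_cases j <;> simp [mul_apply, Fin.sum_univ_three] <;> ring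
    · intro i j
      fin_cases i <;> fin_cases j <;> simp <;> linarith
  · refine ⟨!![ε, 0, 0; 1, μ, -δ; 0, 0, ε], !![1, -ε, 0; 0, 1, 0; 0, 0, -1],
      by simp [det_fin_three], ?_, ?_, by simp⟩
    · ext i j
      fin_cases i <;> fin_cases j <;> simp [mul_apply, Fin.sum_univ_three] <;> ring
    · intro i j
      fin_cases i <;> fin_cases j <;> simp <;> linarith

lemma derog_form_neg {ε μ δ : ℝ} (hε : 0 ≤ ε) (hμ : μ < 0) (hs : 0 ≤ ε + μ) :
    HessSim !![0, -(ε * μ), -(ε * δ); 1, μ + ε, δ; 0, 0, ε] := by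
  have hne : μ - ε ≠ 0 := by linarith
  obtain ⟨k, hk⟩ : ∃ k, k * (μ - ε) = δ := ⟨δ / (μ - ε), by field_simp⟩
  refine ⟨!![0, -(ε * μ), 0; 1, μ + ε, 0; 0, 0, ε], !![1, 0, k * ε; 0, 1, -k; 0, 0, 1],
      by simp [det_fin_three], ?_, ?_, by simp⟩
  · subst hk
    ext i j
    fin_cases i <;> fin_cases j <;> simp [mul_apply, Fin.sum_univ_three] <;> ring
  · have : 0 ≤ -(ε * μ) := by nlinarith
    intro i j
    fin_cases i <;> fin_cases j <;> simp <;> linarith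

lemma rank_one_of {A : Matrix (Fin 3) (Fin 3) ℝ} {ε : ℝ}
    (hr : (A - ε • (1 : Matrix (Fin 3) (Fin 3) ℝ)).rank ≤ 1) (hg : A 2 0 ≠ 0) :
    ε ∈ spectrum ℝ A ∧ Module.finrank ℝ (LinearMap.ker (Matrix.mulVecLin
              (A - ε • (1 : Matrix (Fin 3) (Fin 3) ℝ)))) = 2 := by
  have hrn := LinearMap.finrank_range_add_finrank_ker
    (Matrix.mulVecLin (A - ε • (1 : Matrix (Fin 3) (Fin 3) ℝ)))
  have h3 : Module.finrank ℝ (Fin 3 → ℝ) = 3 := by simp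
  rw [h3] at hrn
  have hdef : (A - ε • (1 : Matrix (Fin 3) (Fin 3) ℝ)).rank = Module.finrank ℝ
    (LinearMap.range (Matrix.mulVecLin (A - ε • (1 : Matrix (Fin 3) (Fin 3) ℝ)))) := rfl
  constructor
  · rw [spectrum.mem_iff]
    intro hu
    rw [← IsUnit.neg_iff, neg_sub, Algebra.algebraMap_eq_smul_one] at hu
    have := rank_of_isUnit _ hu
    simp at this
    omega
  · have hne : (A - ε • (1 : Matrix (Fin 3) (Fin 3) ℝ)).rank ≠ 0 := by
      intro h0
      rw [hdef, Submodule.finrank_eq_zero, LinearMap.range_eq_bot] at h0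
      have h1 := congrFun (LinearMap.congr_fun h0 (Pi.single 0 1)) 2
      simp at h1
      exact hg h1
    omega

lemma derog_case {a b c d e f g h i : ℝ} (ha : 0 ≤ a) (he : 0 ≤ e) (hi : 0 ≤ i)
    (hb : 0 ≤ b) (hc : 0 ≤ c) (hd : 0 ≤ d) (hf : 0 ≤ f)
    (hg : 0 ≤ g) (hh : 0 ≤ h) (hg0 : g ≠ 0)
    (hv : ∀ v, (kry !![a,b,c;d,e,f;g,h,i] v).det = 0)
    (hno : ∀ ε : ℝ, (!![a,b,c;d,e,f;g,h,i] - ε • (1 : Matrix (Fin 3) (Fin 3) ℝ)).rank ≤ 1 → 0 ≤ ε) :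
    HessSim !![a,b,c;d,e,f;g,h,i] := by
  obtain ⟨β, hβ⟩ : ∃ β, g * β = g*a + h*d + i*g := ⟨(g*a + h*d + i*g)/g, by field_simp⟩
  obtain ⟨δ, hδ⟩ : ∃ δ, g * δ = h := ⟨h/g, by field_simp⟩
  obtain ⟨α, hα⟩ : ∃ α, α = a*a + b*d + c*g - β * a := ⟨_, rfl⟩
  obtain ⟨γ, hγ⟩ : ∃ γ, γ = b - a * δ := ⟨_, rfl⟩
  obtain ⟨ε, hε⟩ : ∃ ε, ε = e - d * δ := ⟨_, rfl⟩
  have hdet : (!![1, a, 0; 0, d, 1; 0, g, 0] : Matrix (Fin 3) (Fin 3) ℝ).det ≠ 0 := by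
    simp [det_fin_three, hg0]
  have hdb : d * β = d*a + e*d + f*g := by
    have := hv ![1, 0, 0]
    simp [kry, det_fin_three, mulVec, dotProduct, Fin.sum_univ_three] at this
    apply mul_left_cancel₀ hg0
    linear_combination d * hβ + this
  have hAK : !![a,b,c;d,e,f;g,h,i] * !![1, a, 0; 0, d, 1; 0, g, 0]
      = !![1, a, 0; 0, d, 1; 0, g, 0] * !![0, α, γ; 1, β, δ; 0, 0, ε] := by
    ext j k
    fin_cases j <;> fin_cases k <;> simp [mul_apply, Fin.sum_univ_three] <;> linarith
  have hk : ∀ y, (kry !![0, α, γ; 1, β, δ; 0, 0, ε] y).det = 0 := by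
    intro y
    have h1 := hv (!![1, a, 0; 0, d, 1; 0, g, 0] *ᵥ y)
    rw [kry_sim hAK, det_mul] at h1
    exact (mul_eq_zero.mp h1).resolve_left hdet
  obtain ⟨c1, c2⟩ := derog_conditions hk
  clear hα hγ
  obtain ⟨μ, hμ⟩ : ∃ μ, μ = β - ε := ⟨_, rfl⟩
  have hβ' : β = μ + ε := by linarith
  rw [← hμ] at c1
  subst c1 c2
  rw [hβ'] at hAK
  have hε0 : 0 ≤ ε := by
    apply hno
    set K : Matrix (Fin 3) (Fin 3) ℝ := !![1, a, 0; 0, d, 1; 0, g, 0] with hK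
    have e1 : (!![a,b,c;d,e,f;g,h,i] - ε • (1 : Matrix (Fin 3) (Fin 3) ℝ)) * K
        = K * vecMulVec ![-ε, 1, 0] ![1, μ, δ] := by
      rw [sub_mul, hAK, smul_mul_assoc, one_mul,
        show ε • K = K * (ε • (1 : Matrix (Fin 3) (Fin 3) ℝ)) by simp, ← mul_sub]
      congr 1
      ext j k
      fin_cases j <;> fin_cases k <;> simp [vecMulVec_apply]
    rw [← rank_mul_eq_left_of_det_ne_zero K _ hdet, e1]
    exact (rank_mul_le_right _ _).trans (rank_vecMulVec_le _ _)
  refine HessSim.trans hdet hAK ?_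
  by_cases hμ0 : 0 ≤ μ
  · exact derog_form_pos hε0 hμ0
  · refine derog_form_neg hε0 (not_le.mp hμ0) ?_
    refine dominate ha he hi hb hc hd hf hg hh (x := ε) (y := ε) (z := μ) ?_
      (not_le.mp hμ0) le_rfl
    intro w
    rw [← det_cp, det_sim hdet hAK, det_cp]
    unfold cp; ring

lemma forward {A B T : Matrix (Fin 3) (Fin 3) ℝ} (hT : T.det ≠ 0) (hB : T⁻¹ * A * T = B)
    (hB0 : ∀ i j, 0 ≤ B i j) (hz : B 2 0 = 0) {μ : ℝ} (hμ : μ < 0) :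
    2 ≤ (A - μ • (1 : Matrix (Fin 3) (Fin 3) ℝ)).rank := by
  have hu : IsUnit T.det := isUnit_iff_ne_zero.mpr hT
  have h1 : B - μ • (1 : Matrix (Fin 3) (Fin 3) ℝ) = T⁻¹ * (A - μ • 1) * T := by
    rw [mul_sub, sub_mul, hB]; simp [nonsing_inv_mul _ hu]
  have h2 : (B - μ • (1 : Matrix (Fin 3) (Fin 3) ℝ)).rank ≤
      (A - μ • (1 : Matrix (Fin 3) (Fin 3) ℝ)).rank := by
    rw [h1]; exact (rank_mul_le_left _ _).trans (rank_mul_le_right _ _)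
  refine le_trans ?_ h2
  have h3 : ((B - μ • (1 : Matrix (Fin 3) (Fin 3) ℝ)).submatrix ![0, 2] ![0, 2]).rank = 2 := by
    rw [rank_of_det_ne_zero]
    · simp
    · have p0 := hB0 0 0
      have p2 := hB0 2 2
      rw [det_fin_two]
      simp [hz]
      constructor <;> linarith
  rw [← h3]
  exact rank_submatrix_le _ _ _

/-- A 3×3 nonnegative matrix is similar (over ℝ) to a nonnegative upper
Hessenberg matrix iff it has no negative eigenvalue of geometric multiplicity 2. -/
theorem nonneg_3x3_similar_nonneg_hessenberg_iff
    (A : Matrix (Fin 3) (Fin 3) ℝ) (hA : ∀ i j, 0 ≤ A i j) :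
    (∃ (B T : Matrix (Fin 3) (Fin 3) ℝ), T.det ≠ 0 ∧ T⁻¹ * A * T = B ∧
        (∀ i j, 0 ≤ B i j) ∧ (∀ i j : Fin 3, (j : ℕ) + 1 < (i : ℕ) → B i j = 0)) ↔
      ¬ ∃ μ : ℝ, μ < 0 ∧ μ ∈ spectrum ℝ A ∧
          Module.finrank ℝ
            (LinearMap.ker (Matrix.mulVecLin
              (A - μ • (1 : Matrix (Fin 3) (Fin 3) ℝ)))) = 2 := by
  constructor
  · rintro ⟨B, T, hT, hB, hB0, hz⟩ ⟨μ, hμ, -, hk⟩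
    have h1 := forward hT hB hB0 (hz 2 0 (by decide)) hμ
    have hrn := LinearMap.finrank_range_add_finrank_ker
      (Matrix.mulVecLin (A - μ • (1 : Matrix (Fin 3) (Fin 3) ℝ)))
    have h3 : Module.finrank ℝ (Fin 3 → ℝ) = 3 := by simp
    rw [h3, hk] at hrn
    unfold Matrix.rank at h1
    omega
  · intro hno
    have main : HessSim A := by
      by_cases hg0 : A 2 0 = 0
      · exact ⟨A, 1, by simp, by simp, hA, hg0⟩
      have hAeq := eta_fin_three A
      by_cases hv : ∃ v, (kry A v).det ≠ 0
      · obtain ⟨v, hv⟩ := hv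
        rw [hAeq] at hv ⊢
        exact cyclic_case (hA _ _) (hA _ _) (hA _ _) (hA _ _) (hA _ _) (hA _ _) (hA _ _)
          (hA _ _) (hA _ _) v hv
      · push Not at hv
        have hno' : ∀ ε : ℝ, (A - ε • (1 : Matrix (Fin 3) (Fin 3) ℝ)).rank ≤ 1 → 0 ≤ ε := by
          intro ε hr
          by_contra hε
          exact hno ⟨ε, not_le.mp hε, rank_one_of hr hg0⟩
        rw [hAeq] at hv hno' ⊢
        exact derog_case (hA _ _) (hA _ _) (hA _ _) (hA _ _) (hA _ _) (hA _ _) (hA _ _)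
          (hA _ _) (hA _ _) hg0 hv hno'
    obtain ⟨B, T, hT, h1, h2, h3⟩ := main
    refine ⟨B, T, hT, ?_, h2, ?_⟩
    · rw [mul_assoc, h1, ← mul_assoc, nonsing_inv_mul _ (isUnit_iff_ne_zero.mpr hT), one_mul]
    · intro i j hij
      fin_cases i <;> fin_cases j <;> simp at hij ⊢
      exact h3
end

section
/- Every 4×4 Metzler matrix A is similar, via a nonnegative invertible matrix T, to a Metzler upper Hessenberg matrix T⁻¹AT. -/
open Matrix

/-- Nonnegative-similarity to a Metzler Hessenberg matrix, in the division-free form `A T = T H`. -/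
def Good (A : Matrix (Fin 4) (Fin 4) ℝ) : Prop :=
  ∃ T H : Matrix (Fin 4) (Fin 4) ℝ, (∀ i j, 0 ≤ T i j) ∧ T.det ≠ 0 ∧ A * T = T * H ∧
    (∀ i j, i ≠ j → 0 ≤ H i j) ∧ H 2 0 = 0 ∧ H 3 0 = 0 ∧ H 3 1 = 0

lemma good_perm (A : Matrix (Fin 4) (Fin 4) ℝ) (σ : Equiv.Perm (Fin 4))
    (h : Good (A.submatrix σ σ)) : Good A := by
  obtain ⟨T, H, hT, hd, he, hH⟩ := h
  refine ⟨T.submatrix σ.symm id, H, fun i j => hT _ _, ?_, ?_, hH⟩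
  · have := Matrix.det_permute σ.symm T
    rw [show T.submatrix σ.symm id = T.submatrix (σ.symm) id from rfl, this]
    refine mul_ne_zero ?_ hd
    rcases Int.units_eq_one_or (Equiv.Perm.sign σ.symm) with h | h <;> simp [h]
  · ext i j
    have := congrFun (congrFun he (σ.symm i)) j
    simp only [Matrix.mul_apply, Matrix.submatrix_apply, id, Equiv.apply_symm_apply] at this ⊢
    rw [← this]
    rw [← Equiv.sum_comp σ]
    simp

/-- Larger root of a 2×2 block. -/
lemma root2 (a e p : ℝ) (hp : 0 ≤ p) : ∃ m, a ≤ m ∧ e ≤ m ∧ (m - a) * (m - e) = p := by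
  have h0 : 0 ≤ (a - e)^2 + 4 * p := by positivity
  have hs := Real.sq_sqrt h0
  have h1 : |a - e| ≤ √((a - e)^2 + 4 * p) := Real.abs_le_sqrt (by linarith)
  have h2 := abs_le.1 h1
  refine ⟨(a + e + √((a - e)^2 + 4 * p)) / 2, by linarith, by linarith, ?_⟩
  nlinarith

/-- Perron root of a 3×3 Metzler matrix, with the minors of `l - B` nonnegative. -/
lemma perron3 (a b c d e f g h i : ℝ) (hb : 0 ≤ b) (hc : 0 ≤ c) (hd : 0 ≤ d) (hf : 0 ≤ f)
    (hg : 0 ≤ g) (hh : 0 ≤ h) :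
    ∃ l, a ≤ l ∧ e ≤ l ∧ i ≤ l ∧ b * d ≤ (l - a) * (l - e) ∧ c * g ≤ (l - a) * (l - i) ∧
      f * h ≤ (l - e) * (l - i) ∧
      (l - a) * (l - e) * (l - i) - (l - a) * (f * h) - (l - e) * (c * g) - (l - i) * (b * d)
        - b * f * g - c * d * h = 0 := by
  obtain ⟨m1, h1a, h1b, h1⟩ := root2 a e (b * d) (by positivity)
  obtain ⟨m2, h2a, h2b, h2⟩ := root2 a i (c * g) (by positivity)
  obtain ⟨m3, h3a, h3b, h3⟩ := root2 e i (f * h) (by positivity)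
  have p1 : 0 ≤ b * d := by positivity
  have p2 : 0 ≤ c * g := by positivity
  have p3 : 0 ≤ f * h := by positivity
  have p4 : 0 ≤ b * f * g := by positivity
  have p5 : 0 ≤ c * d * h := by positivity
  have key : ∃ m, m1 ≤ m ∧ m2 ≤ m ∧ m3 ≤ m ∧
      (m - a) * (m - e) * (m - i) - (m - a) * (f * h) - (m - e) * (c * g) - (m - i) * (b * d)
        - b * f * g - c * d * h ≤ 0 := by
    rcases le_total m1 m2 with h12 | h12
    · rcases le_total m2 m3 with h23 | h23
      · refine ⟨m3, by linarith, h23, le_refl _, ?_⟩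
        have q1 : 0 ≤ (m3 - e) * (c * g) := mul_nonneg (by linarith) p2
        have q2 : 0 ≤ (m3 - i) * (b * d) := mul_nonneg (by linarith) p1
        have : (m3 - a) * (m3 - e) * (m3 - i) = (m3 - a) * (f * h) := by rw [← h3]; ring
        linarith
      · refine ⟨m2, h12, le_refl _, h23, ?_⟩
        have q1 : 0 ≤ (m2 - a) * (f * h) := mul_nonneg (by linarith) p3
        have q2 : 0 ≤ (m2 - i) * (b * d) := mul_nonneg (by linarith) p1
        have : (m2 - a) * (m2 - e) * (m2 - i) = (m2 - e) * (c * g) := by rw [← h2]; ring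
        linarith
    · rcases le_total m1 m3 with h13 | h13
      · refine ⟨m3, by linarith, by linarith, le_refl _, ?_⟩
        have q1 : 0 ≤ (m3 - e) * (c * g) := mul_nonneg (by linarith) p2
        have q2 : 0 ≤ (m3 - i) * (b * d) := mul_nonneg (by linarith) p1
        have : (m3 - a) * (m3 - e) * (m3 - i) = (m3 - a) * (f * h) := by rw [← h3]; ring
        linarith
      · refine ⟨m1, le_refl _, h12, h13, ?_⟩
        have q1 : 0 ≤ (m1 - a) * (f * h) := mul_nonneg (by linarith) p3
        have q2 : 0 ≤ (m1 - e) * (c * g) := mul_nonneg (by linarith) p2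
        have : (m1 - a) * (m1 - e) * (m1 - i) = (m1 - i) * (b * d) := by rw [← h1]; ring
        linarith
  obtain ⟨m, hm1, hm2, hm3, hm⟩ := key
  set R := b + c + d + f + g + h with hR
  have hR0 : 0 ≤ R := by positivity
  set N := m + 3 * R with hN
  have hx : 3 * R ≤ N - a := by linarith
  have hy : 3 * R ≤ N - e := by linarith
  have hz : 3 * R ≤ N - i := by linarith
  have hpos : 0 ≤ (N - a) * (N - e) * (N - i) - (N - a) * (f * h) - (N - e) * (c * g)
      - (N - i) * (b * d) - b * f * g - c * d * h := by
    generalize N - a = x at *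
    generalize N - e = y at *
    generalize N - i = z at *
    have hx0 : 0 ≤ x := by linarith
    have hy0 : 0 ≤ y := by linarith
    have hz0 : 0 ≤ z := by linarith
    have e1 : f * h ≤ (y/3) * (z/3) := mul_le_mul (by linarith) (by linarith) hh (by linarith)
    have e2 : c * g ≤ (x/3) * (z/3) := mul_le_mul (by linarith) (by linarith) hg (by linarith)
    have e3 : b * d ≤ (x/3) * (y/3) := mul_le_mul (by linarith) (by linarith) hd (by linarith)
    have e4 : b * f * g ≤ (x/3) * (y/3) * (z/3) :=
      mul_le_mul (mul_le_mul (by linarith) (by linarith) hf (by linarith)) (by linarith) hg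
        (by positivity)
    have e5 : c * d * h ≤ (x/3) * (y/3) * (z/3) :=
      mul_le_mul (mul_le_mul (by linarith) (by linarith) hd (by linarith)) (by linarith) hh
        (by positivity)
    have e1' := mul_le_mul_of_nonneg_left e1 hx0
    have e2' := mul_le_mul_of_nonneg_left e2 hy0
    have e3' := mul_le_mul_of_nonneg_left e3 hz0
    have : 0 ≤ x * y * z := by positivity
    nlinarith
  have hc' : ContinuousOn (fun l : ℝ => (l - a) * (l - e) * (l - i) - (l - a) * (f * h)
      - (l - e) * (c * g) - (l - i) * (b * d) - b * f * g - c * d * h) (Set.Icc m N) := by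
    fun_prop
  obtain ⟨l, hl, hl0⟩ := intermediate_value_Icc (by linarith : m ≤ N) hc' ⟨hm, hpos⟩
  have hl1 := hl.1
  refine ⟨l, by linarith, by linarith, by linarith, ?_, ?_, ?_, hl0⟩
  · rw [← h1]; exact mul_le_mul (by linarith) (by linarith) (by linarith) (by linarith)
  · rw [← h2]; exact mul_le_mul (by linarith) (by linarith) (by linarith) (by linarith)
  · rw [← h3]; exact mul_le_mul (by linarith) (by linarith) (by linarith) (by linarith)

/-- Lifting from the 3×3 pair to the 4×4 matrix. -/
lemma lift3 (A : Matrix (Fin 4) (Fin 4) ℝ) (hA : ∀ i j, i ≠ j → 0 ≤ A i j)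
    (T H : Matrix (Fin 3) (Fin 3) ℝ) (hT : ∀ i j, 0 ≤ T i j) (hd : T.det ≠ 0)
    (he : (A.submatrix Fin.succ Fin.succ) * T = T * H) (hH : ∀ i j, i ≠ j → 0 ≤ H i j)
    (h20 : H 2 0 = 0) (s : ℝ) (hs : 0 ≤ s) (hb : ∀ i : Fin 3, A i.succ 0 = s * T i 0) :
    Good A := by
  refine ⟨!![1, 0, 0, 0; 0, T 0 0, T 0 1, T 0 2; 0, T 1 0, T 1 1, T 1 2; 0, T 2 0, T 2 1, T 2 2],
    !![A 0 0, A 0 1 * T 0 0 + A 0 2 * T 1 0 + A 0 3 * T 2 0,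
        A 0 1 * T 0 1 + A 0 2 * T 1 1 + A 0 3 * T 2 1,
        A 0 1 * T 0 2 + A 0 2 * T 1 2 + A 0 3 * T 2 2;
       s, H 0 0, H 0 1, H 0 2; 0, H 1 0, H 1 1, H 1 2; 0, H 2 0, H 2 1, H 2 2],
    ?_, ?_, ?_, ?_, by simp, by simp, by simp [h20]⟩
  · intro i j
    fin_cases i <;> fin_cases j <;> simp [hT]
  · rw [Matrix.det_fin_three] at hd
    simp [Matrix.det_succ_row_zero, Fin.sum_univ_succ, Fin.succAbove]
    intro h
    apply hd
    linarith
  · have e := fun i j => congrFun (congrFun he i) j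
    simp [Matrix.mul_apply, Fin.sum_univ_three] at e
    have b0 := hb 0
    have b1 := hb 1
    have b2 := hb 2
    simp at b0 b1 b2
    ext i j
    fin_cases i <;> fin_cases j <;> simp [Matrix.mul_apply, Fin.sum_univ_four]
    · linarith
    · have := e 0 0; simp at this; linarith
    · have := e 0 1; simp at this; linarith
    · have := e 0 2; simp at this; linarith
    · linarith
    · have := e 1 0; simp at this; linarith
    · have := e 1 1; simp at this; linarith
    · have := e 1 2; simp at this; linarith
    · linarith
    · have := e 2 0; simp at this; linarith
    · have := e 2 1; simp at this; linarith
    · have := e 2 2; simp at this; linarith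
  · have r1 : 0 ≤ A 0 1 := hA _ _ (by decide)
    have r2 : 0 ≤ A 0 2 := hA _ _ (by decide)
    have r3 : 0 ≤ A 0 3 := hA _ _ (by decide)
    have q : ∀ j, 0 ≤ A 0 1 * T 0 j + A 0 2 * T 1 j + A 0 3 * T 2 j := fun j => by
      have := hT 0 j; have := hT 1 j; have := hT 2 j; positivity
    intro i j hij
    fin_cases i <;> fin_cases j <;> simp [q, hs] at hij ⊢
    all_goals exact hH _ _ (by decide)


/-- The algebra of the cyclic case: `T = K U`, `B K = K C`, `C U = U H`. -/
lemma cyc_core (K B : Matrix (Fin 3) (Fin 3) ℝ) (t e2 e3 : ℝ) (hK : K.det ≠ 0)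
    (hBK : B * K = K * !![0, 0, e3; 1, 0, -e2; 0, 1, t])
    (r y x γ α β : ℝ) (hx : 0 ≤ x) (hα : 0 ≤ α) (hβ : 0 ≤ β)
    (ht : γ + y + r = t)
    (h2 : γ * y + γ * r + y * r - x - β = e2)
    (h3 : γ * (y * r - x) - β * r + α = e3)
    (hK0 : ∀ i, 0 ≤ K i 0) (hK1 : ∀ i, 0 ≤ K i 1 - r * K i 0)
    (hK2 : ∀ i, 0 ≤ K i 2 - (r + y) * K i 1 + (r * y - x) * K i 0) :
    ∃ T H : Matrix (Fin 3) (Fin 3) ℝ, (∀ i j, 0 ≤ T i j) ∧ T.det ≠ 0 ∧ B * T = T * H ∧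
      (∀ i j, i ≠ j → 0 ≤ H i j) ∧ H 2 0 = 0 ∧ ∀ i, T i 0 = K i 0 := by
  refine ⟨K * !![1, -r, r * y - x; 0, 1, -(r + y); 0, 0, 1], !![r, x, α; 1, y, β; 0, 1, γ],
    ?_, ?_, ?_, ?_, by simp, ?_⟩
  · intro i j
    fin_cases j <;> simp [Matrix.mul_apply, Fin.sum_univ_three]
    · exact hK0 i
    · have := hK1 i; linarith
    · have := hK2 i; linarith
  · rw [Matrix.det_mul]
    refine mul_ne_zero hK ?_
    simp [Matrix.det_fin_three]
  · rw [← Matrix.mul_assoc, hBK, Matrix.mul_assoc, Matrix.mul_assoc]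
    congr 1
    subst ht h2 h3
    ext i j
    fin_cases i <;> fin_cases j <;> simp [Matrix.mul_apply, Fin.sum_univ_three] <;> ring
  · intro i j hij
    fin_cases i <;> fin_cases j <;> simp [hx, hα, hβ] at hij ⊢
  · intro i
    simp [Matrix.mul_apply, Fin.sum_univ_three]

/-- The cyclic (controllable) case for a 3×3 pair with sorted diagonal. -/
lemma cyc3 (B : Matrix (Fin 3) (Fin 3) ℝ) (hB : ∀ i j, i ≠ j → 0 ≤ B i j)
    (b : Fin 3 → ℝ) (hb : ∀ i, 0 ≤ b i) (h01 : B 0 0 ≤ B 1 1) (h12 : B 1 1 ≤ B 2 2)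
    (hK : (Matrix.of (fun i (j : Fin 3) => ((B ^ (j : ℕ)) *ᵥ b) i)).det ≠ 0) :
    ∃ T H : Matrix (Fin 3) (Fin 3) ℝ, (∀ i j, 0 ≤ T i j) ∧ T.det ≠ 0 ∧ B * T = T * H ∧
      (∀ i j, i ≠ j → 0 ≤ H i j) ∧ H 2 0 = 0 ∧ ∀ i, T i 0 = b i := by
  set K := Matrix.of (fun i (j : Fin 3) => ((B ^ (j : ℕ)) *ᵥ b) i) with hKdef
  have k0 : ∀ i, K i 0 = b i := fun i => by simp [hKdef]
  have k1 : ∀ i, K i 1 = B i 0 * b 0 + B i 1 * b 1 + B i 2 * b 2 := fun i => by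
    simp [hKdef, Matrix.mulVec, dotProduct, Fin.sum_univ_three]
  have k2 : ∀ i, K i 2 = B i 0 * K 0 1 + B i 1 * K 1 1 + B i 2 * K 2 1 := fun i => by
    have : K i 2 = (B *ᵥ (B *ᵥ b)) i := by
      simp [hKdef, pow_two, Matrix.mulVec_mulVec]
    rw [this, k1, k1, k1]
    simp [Matrix.mulVec, dotProduct, Fin.sum_univ_three]
  clear_value K
  have b01 := hB 0 1 (by decide)
  have b02 := hB 0 2 (by decide)
  have b10 := hB 1 0 (by decide)
  have b12 := hB 1 2 (by decide)
  have b20 := hB 2 0 (by decide)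
  have b21 := hB 2 1 (by decide)
  have v0 := hb 0
  have v1 := hb 1
  have v2 := hb 2
  have hBK : B * K = K * !![0, 0, B.det; 1, 0, -(B 0 0 * B 1 1 + B 0 0 * B 2 2 + B 1 1 * B 2 2
      - B 0 1 * B 1 0 - B 0 2 * B 2 0 - B 1 2 * B 2 1); 0, 1, B 0 0 + B 1 1 + B 2 2] := by
    rw [Matrix.det_fin_three]
    ext i j
    fin_cases i <;> fin_cases j <;>
      simp [Matrix.mul_apply, Fin.sum_univ_three, k0, k1, k2] <;> ring
  rw [Matrix.det_fin_three] at hBK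
  simp only [← k0]
  -- choice of r, y
  have key : ∃ r y : ℝ, B 0 0 ≤ r ∧ r ≤ B 1 1 ∧ (y = B 1 1 ∨ (r = B 1 1 ∧ y = B 0 0)) ∧
      (∀ i, 0 ≤ K i 1 - r * K i 0) ∧ (∀ i, 0 ≤ K i 2 - (r + y) * K i 1 + (r * y) * K i 0) := by
    by_cases h : B 1 1 * b 0 ≤ K 0 1
    · have n0 : 0 ≤ K 0 1 - B 1 1 * b 0 := by linarith
      have n1 : 0 ≤ K 1 1 - B 1 1 * b 1 := by
        rw [k1]; have : 0 ≤ B 1 0 * b 0 + B 1 2 * b 2 := by positivity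
        linarith
      have n2 : 0 ≤ K 2 1 - B 1 1 * b 2 := by
        rw [k1]; have : 0 ≤ B 2 0 * b 0 + B 2 1 * b 1 := by positivity
        nlinarith
      refine ⟨B 1 1, B 0 0, h01, le_refl _, Or.inr ⟨rfl, rfl⟩, ?_, ?_⟩
      · intro i; fin_cases i <;> simp only [k0] <;> assumption
      · have d1 : 0 ≤ B 1 1 - B 0 0 := by linarith
        have d2 : 0 ≤ B 2 2 - B 0 0 := by linarith
        intro i; rw [k2, k0]
        have e0 := k1 0
        have e1 := k1 1
        have e2 := k1 2
        fin_cases i <;> simp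
        · have : 0 ≤ B 0 1 * (K 1 1 - B 1 1 * b 1) + B 0 2 * (K 2 1 - B 1 1 * b 2) := by positivity
          linear_combination this + B 1 1 * e0
        · have : 0 ≤ B 1 0 * (K 0 1 - B 1 1 * b 0) + (B 1 1 - B 0 0) * (K 1 1 - B 1 1 * b 1)
            + B 1 2 * (K 2 1 - B 1 1 * b 2) := by positivity
          linear_combination this + B 1 1 * e1
        · have : 0 ≤ B 2 0 * (K 0 1 - B 1 1 * b 0) + (B 2 2 - B 0 0) * (K 2 1 - B 1 1 * b 2)
            + B 2 1 * (K 1 1 - B 1 1 * b 1) := by positivity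
          linear_combination this + B 1 1 * e2
    · push Not at h
      have hb0 : 0 < b 0 := by
        rcases v0.lt_or_eq with h' | h'
        · exact h'
        · rw [k1, ← h'] at h
          have : 0 ≤ B 0 1 * b 1 + B 0 2 * b 2 := by positivity
          linarith
      obtain ⟨r, hr⟩ : ∃ r, r * b 0 = K 0 1 := ⟨K 0 1 / b 0, by field_simp⟩
      have hr1 : r ≤ B 1 1 := by
        by_contra hh; push Not at hh; nlinarith
      have hr0 : B 0 0 ≤ r := by
        by_contra hh; push Not at hh
        have := k1 0
        have : 0 ≤ B 0 1 * b 1 + B 0 2 * b 2 := by positivity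
        nlinarith
      have n1 : 0 ≤ K 1 1 - r * b 1 := by
        rw [k1]; have : 0 ≤ B 1 0 * b 0 + B 1 2 * b 2 := by positivity
        nlinarith
      have n2 : 0 ≤ K 2 1 - r * b 2 := by
        rw [k1]; have : 0 ≤ B 2 0 * b 0 + B 2 1 * b 1 := by positivity
        nlinarith
      refine ⟨r, B 1 1, hr0, hr1, Or.inl rfl, ?_, ?_⟩
      · intro i; fin_cases i <;> simp only [k0]
        · simp [hr]
        · exact n1
        · exact n2
      · have d2 : 0 ≤ B 2 2 - B 1 1 := by linarith
        intro i; rw [k2, k0]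
        have e0 := k1 0
        have e1 := k1 1
        have e2 := k1 2
        fin_cases i <;> simp
        · have : 0 ≤ B 0 1 * (K 1 1 - r * b 1) + B 0 2 * (K 2 1 - r * b 2) := by positivity
          linear_combination this + r * e0 + (B 0 0 - B 1 1) * hr
        · have : 0 ≤ B 1 2 * (K 2 1 - r * b 2) := by positivity
          linear_combination this + r * e1 + B 1 0 * hr
        · have : 0 ≤ (B 2 2 - B 1 1) * (K 2 1 - r * b 2)
            + B 2 1 * (K 1 1 - r * b 1) := by positivity
          linear_combination this + r * e2 + B 2 0 * hr
  obtain ⟨r, y, hr0, hr1, hy, hp1, hp2⟩ := key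
  have hK0 : ∀ i, 0 ≤ K i 0 := fun i => by rw [k0]; exact hb i
  have off : 0 ≤ B 0 1 * B 1 0 + B 0 2 * B 2 0 + B 1 2 * B 2 1 := by positivity
  by_cases hχ : (r - B 0 0) * (r - B 1 1) * (r - B 2 2) - (r - B 0 0) * (B 1 2 * B 2 1)
      - (r - B 1 1) * (B 0 2 * B 2 0) - (r - B 2 2) * (B 0 1 * B 1 0)
        - B 0 1 * B 1 2 * B 2 0 - B 0 2 * B 1 0 * B 2 1 ≤ 0
  · refine cyc_core K B _ _ _ hK hBK r y 0 (B 0 0 + B 1 1 + B 2 2 - y - r)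
      (-((r - B 0 0) * (r - B 1 1) * (r - B 2 2) - (r - B 0 0) * (B 1 2 * B 2 1)
      - (r - B 1 1) * (B 0 2 * B 2 0) - (r - B 2 2) * (B 0 1 * B 1 0)
        - B 0 1 * B 1 2 * B 2 0 - B 0 2 * B 1 0 * B 2 1))
      ((B 0 0 + B 1 1 + B 2 2 - y - r) * (y + r) + y * r - (B 0 0 * B 1 1 + B 0 0 * B 2 2
        + B 1 1 * B 2 2 - B 0 1 * B 1 0 - B 0 2 * B 2 0 - B 1 2 * B 2 1)) le_rfl
      (by linarith) ?_ (by ring) (by ring) (by ring) hK0 hp1 (by simpa using hp2)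
    rcases hy with rfl | ⟨rfl, rfl⟩
    · have : 0 ≤ (r - B 0 0) * (B 2 2 - r) := mul_nonneg (by linarith) (by linarith)
      nlinarith
    · nlinarith
  · push Not at hχ
    obtain ⟨l, l0, l1, l2, m1, m2, m3, hl⟩ := perron3 (B 0 0) (B 0 1) (B 0 2) (B 1 0) (B 1 1)
      (B 1 2) (B 2 0) (B 2 1) (B 2 2) b01 b02 b10 b12 b20 b21
    set e2 := B 0 0 * B 1 1 + B 0 0 * B 2 2
        + B 1 1 * B 2 2 - B 0 1 * B 1 0 - B 0 2 * B 2 0 - B 1 2 * B 2 1 with he2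
    set t := B 0 0 + B 1 1 + B 2 2 with ht
    -- q(s) = s² - (t - l) s + q0
    set q0 := e2 - l * (t - l) with hq0
    have hx : 0 ≤ r * (t - l - r) - q0 := by
      by_contra hh
      push Not at hh
      have hlr : 0 ≤ l - r := by linarith
      have : 0 ≤ (l - r) * (q0 - r * (t - l - r)) := mul_nonneg hlr (by linarith)
      rw [hq0, ht, he2] at this
      nlinarith
    refine cyc_core K B t e2 _ hK hBK r (t - l - r) (r * (t - l - r) - q0) l 0 0 hx le_rfl le_rfl
      (by ring) (by rw [hq0]; ring) ?_ hK0 hp1 ?_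
    · rw [hq0, he2, ht]; linear_combination hl
    · intro i
      have d0 : 0 ≤ l - B 0 0 := by linarith
      have d1 : 0 ≤ l - B 1 1 := by linarith
      have d2 : 0 ≤ l - B 2 2 := by linarith
      have a0 : 0 ≤ (l - B 1 1) * (l - B 2 2) - B 1 2 * B 2 1 := by linarith
      have a1 : 0 ≤ (l - B 0 0) * (l - B 2 2) - B 0 2 * B 2 0 := by linarith
      have a2 : 0 ≤ (l - B 0 0) * (l - B 1 1) - B 0 1 * B 1 0 := by linarith
      rw [k2, k0, k1, k1, k1, hq0, he2, ht]
      fin_cases i <;> simp [k1]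
      · have : 0 ≤ ((l - B 1 1) * (l - B 2 2) - B 1 2 * B 2 1) * b 0
          + (B 0 1 * (l - B 2 2) + B 0 2 * B 2 1) * b 1
          + (B 0 2 * (l - B 1 1) + B 0 1 * B 1 2) * b 2 := by positivity
        linear_combination this
      · have : 0 ≤ ((l - B 0 0) * (l - B 2 2) - B 0 2 * B 2 0) * b 1
          + (B 1 0 * (l - B 2 2) + B 1 2 * B 2 0) * b 0
          + (B 1 2 * (l - B 0 0) + B 1 0 * B 0 2) * b 2 := by positivity
        linear_combination this
      · have : 0 ≤ ((l - B 0 0) * (l - B 1 1) - B 0 1 * B 1 0) * b 2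
          + (B 2 0 * (l - B 1 1) + B 2 1 * B 1 0) * b 0
          + (B 2 1 * (l - B 0 0) + B 2 0 * B 0 1) * b 1 := by positivity
        linear_combination this

/-- The 3×3 case, with control on where positive eigenvectors go. -/
lemma hess3 (B : Matrix (Fin 3) (Fin 3) ℝ) (hB : ∀ i j, i ≠ j → 0 ≤ B i j) :
    ∃ T H : Matrix (Fin 3) (Fin 3) ℝ, (∀ i j, 0 ≤ T i j) ∧ T.det ≠ 0 ∧ B * T = T * H ∧
      (∀ i j, i ≠ j → 0 ≤ H i j) ∧ H 2 0 = 0 ∧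
      ∀ (a : Fin 3 → ℝ) (ρ : ℝ), (∀ i, 0 < a i) → B *ᵥ a = ρ • a →
        ∃ c : Fin 3 → ℝ, (∀ i, 0 ≤ c i) ∧ T *ᵥ c = a := by
  have b01 := hB 0 1 (by decide)
  have b02 := hB 0 2 (by decide)
  have b10 := hB 1 0 (by decide)
  have b12 := hB 1 2 (by decide)
  have b20 := hB 2 0 (by decide)
  have b21 := hB 2 1 (by decide)
  set D := B 1 0 * (B 2 1 * B 1 0 + B 2 2 * B 2 0) - B 2 0 * (B 1 1 * B 1 0 + B 1 2 * B 2 0) with hD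
  have cases : (0 < B 1 0 ∧ 0 ≤ D) ∨ (0 < B 2 0 ∧ D ≤ 0) ∨ B 2 0 = 0 := by
    rcases b20.lt_or_eq with h2 | h2
    · rcases b10.lt_or_eq with h1 | h1
      · rcases le_total 0 D with h | h
        · exact Or.inl ⟨h1, h⟩
        · exact Or.inr (Or.inl ⟨h2, h⟩)
      · refine Or.inr (Or.inl ⟨h2, ?_⟩)
        rw [hD, ← h1]
        have : 0 ≤ B 2 0 * (B 1 2 * B 2 0) := by positivity
        linarith
    · exact Or.inr (Or.inr h2.symm)
  rcases cases with ⟨h1, h⟩ | ⟨h2, h⟩ | h2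
  · refine ⟨!![1, 0, 0; 0, B 1 0, 0; 0, B 2 0, 1],
      !![B 0 0, B 0 1 * B 1 0 + B 0 2 * B 2 0, B 0 2;
         1, (B 1 1 * B 1 0 + B 1 2 * B 2 0) / B 1 0, B 1 2 / B 1 0;
         0, D / B 1 0, B 2 2 - B 1 2 * B 2 0 / B 1 0], ?_, ?_, ?_, ?_, by simp, ?_⟩
    · intro i j; fin_cases i <;> fin_cases j <;> simp [b10, b20]
    · simp [Matrix.det_fin_three, h1.ne']
    · ext i j
      fin_cases i <;> fin_cases j <;> simp [Matrix.mul_apply, Fin.sum_univ_three, hD] <;>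
        field_simp <;> ring
    · intro i j hij
      fin_cases i <;> fin_cases j <;> simp at hij ⊢ <;> positivity
    · intro a ρ ha hρ
      have f1 := congrFun hρ 1
      have f2 := congrFun hρ 2
      simp [Matrix.mulVec, dotProduct, Fin.sum_univ_three] at f1 f2
      have a0 := ha 0
      have a1 := ha 1
      have a2 := ha 2
      have hc3 : 0 ≤ a 2 - a 1 / B 1 0 * B 2 0 := by
        rcases b20.lt_or_eq with h2 | h2
        · -- (ρ - h33) c3 = D / b1 * c2
          have hr : B 2 2 < ρ := by
            by_contra hh; push Not at hh
            have : 0 < B 2 0 * a 0 := by positivity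
            have : 0 ≤ B 2 1 * a 1 := by positivity
            nlinarith
          have e : (ρ - (B 2 2 - B 1 2 * B 2 0 / B 1 0)) * (a 2 - a 1 / B 1 0 * B 2 0)
              = D / B 1 0 * (a 1 / B 1 0) := by
            rw [hD]; field_simp
            linear_combination (B 1 0)^2 * (-f2) + B 1 0 * B 2 0 * f1
          have p : 0 < ρ - (B 2 2 - B 1 2 * B 2 0 / B 1 0) := by
            have : 0 ≤ B 1 2 * B 2 0 / B 1 0 := by positivity
            linarith
          have : 0 ≤ D / B 1 0 * (a 1 / B 1 0) := by positivity
          rw [← e] at this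
          exact nonneg_of_mul_nonneg_right this p
        · rw [← h2]; simp; exact a2.le
      refine ⟨![a 0, a 1 / B 1 0, a 2 - a 1 / B 1 0 * B 2 0], ?_, ?_⟩
      · intro i; fin_cases i
        · exact a0.le
        · simp; positivity
        · exact hc3
      · ext i; fin_cases i <;> simp [Matrix.mulVec, dotProduct, Fin.sum_univ_three] <;>
          field_simp
        try ring
  · refine ⟨!![1, 0, 0; 0, B 1 0, 1; 0, B 2 0, 0],
      !![B 0 0, B 0 1 * B 1 0 + B 0 2 * B 2 0, B 0 1;
         1, (B 2 1 * B 1 0 + B 2 2 * B 2 0) / B 2 0, B 2 1 / B 2 0;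
         0, (-D) / B 2 0, B 1 1 - B 2 1 * B 1 0 / B 2 0], ?_, ?_, ?_, ?_, by simp, ?_⟩
    · intro i j; fin_cases i <;> fin_cases j <;> simp [b10, b20]
    · simp [Matrix.det_fin_three, h2.ne']
    · ext i j
      fin_cases i <;> fin_cases j <;> simp [Matrix.mul_apply, Fin.sum_univ_three, hD] <;>
        field_simp <;> ring
    · have h' : 0 ≤ -D := by linarith
      intro i j hij
      fin_cases i <;> fin_cases j <;> simp only [ne_eq] at hij ⊢ <;> simp at hij ⊢ <;>
        positivity
    · intro a ρ ha hρ
      have h' : 0 ≤ -D := by linarith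
      have f1 := congrFun hρ 1
      have f2 := congrFun hρ 2
      simp [Matrix.mulVec, dotProduct, Fin.sum_univ_three] at f1 f2
      have a0 := ha 0
      have a1 := ha 1
      have a2 := ha 2
      have hc3 : 0 ≤ a 1 - a 2 / B 2 0 * B 1 0 := by
        rcases b10.lt_or_eq with h1 | h1
        · have hr : B 1 1 < ρ := by
            by_contra hh; push Not at hh
            have : 0 < B 1 0 * a 0 := by positivity
            have : 0 ≤ B 1 2 * a 2 := by positivity
            nlinarith
          have e : (ρ - (B 1 1 - B 2 1 * B 1 0 / B 2 0)) * (a 1 - a 2 / B 2 0 * B 1 0)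
              = (-D) / B 2 0 * (a 2 / B 2 0) := by
            rw [hD]; field_simp
            linear_combination (B 2 0)^2 * (-f1) + B 1 0 * B 2 0 * f2
          have p : 0 < ρ - (B 1 1 - B 2 1 * B 1 0 / B 2 0) := by
            have : 0 ≤ B 2 1 * B 1 0 / B 2 0 := by positivity
            linarith
          have : 0 ≤ (-D) / B 2 0 * (a 2 / B 2 0) := by
            generalize -D = E at *; positivity
          rw [← e] at this
          exact nonneg_of_mul_nonneg_right this p
        · rw [← h1]; simp; exact a1.le
      refine ⟨![a 0, a 2 / B 2 0, a 1 - a 2 / B 2 0 * B 1 0], ?_, ?_⟩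
      · intro i; fin_cases i
        · exact a0.le
        · simp; positivity
        · exact hc3
      · ext i; fin_cases i <;> simp [Matrix.mulVec, dotProduct, Fin.sum_univ_three] <;>
          field_simp
        try ring
  · refine ⟨1, B, ?_, by simp, by simp, hB, h2, fun a ρ ha _ => ⟨a, fun i => (ha i).le, by simp⟩⟩
    intro i j
    by_cases h : i = j <;> simp [Matrix.one_apply, h]

/-- The only possible proper invariant coordinate subspace is the complement of index `0`. -/
def Irr0 (A : Matrix (Fin 4) (Fin 4) ℝ) : Prop :=
  ∀ S : Finset (Fin 4), (∀ l, l ∉ S → ∀ k ∈ S, A l k = 0) → S = ∅ ∨ S = Finset.univ ∨ S = {0}ᶜ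

lemma zero_of_supp (A : Matrix (Fin 4) (Fin 4) ℝ) (hA : ∀ i j, i ≠ j → 0 ≤ A i j)
    (v : Fin 4 → ℝ) (hv : ∀ i, 0 ≤ v i) (m : ℝ) (he : A *ᵥ v = m • v) (l k : Fin 4)
    (hl : v l = 0) (hk : 0 < v k) : A l k = 0 := by
  have h := congrFun he l
  simp only [Matrix.mulVec, dotProduct, Pi.smul_apply, hl, smul_zero] at h
  have hn : ∀ j ∈ Finset.univ, 0 ≤ A l j * v j := by
    intro j _
    by_cases hj : l = j
    · subst hj; simp [hl]
    · exact mul_nonneg (hA _ _ hj) (hv j)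
  have := (Finset.sum_eq_zero_iff_of_nonneg hn).1 h k (Finset.mem_univ _)
  rcases mul_eq_zero.1 this with h | h
  · exact h
  · exact absurd h hk.ne'

lemma pos_of_irr (A : Matrix (Fin 4) (Fin 4) ℝ) (hA : ∀ i j, i ≠ j → 0 ≤ A i j) (hI : Irr0 A)
    (v : Fin 4 → ℝ) (hv : ∀ i, 0 ≤ v i) (hne : v ≠ 0) (m : ℝ) (he : A *ᵥ v = m • v) :
    ∀ k, k ≠ 0 → 0 < v k := by
  have := hI (Finset.univ.filter (fun k => 0 < v k)) (by
    intro l hl k hk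
    simp at hl hk
    exact zero_of_supp A hA v hv m he l k (le_antisymm hl (hv l)) hk)
  intro k hk
  rcases this with h | h | h
  · exfalso; apply hne
    ext j
    by_contra hj
    have : j ∈ Finset.univ.filter (fun k => 0 < v k) := by
      simp; exact lt_of_le_of_ne (hv j) (Ne.symm hj)
    rw [h] at this; simp at this
  · have : k ∈ Finset.univ.filter (fun k => 0 < v k) := by rw [h]; simp
    simpa using this
  · have : k ∈ Finset.univ.filter (fun k => 0 < v k) := by rw [h]; simpa using hk
    simpa using this

/-- Spectral gap: the quotient eigenvalue is strictly below the Perron root. -/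
lemma gap (A : Matrix (Fin 4) (Fin 4) ℝ) (hA : ∀ i j, i ≠ j → 0 ≤ A i j) (hI : Irr0 A)
    (v : Fin 4 → ℝ) (hv : ∀ i, 0 ≤ v i) (hne : v ≠ 0) (m : ℝ) (he : A *ᵥ v = m • v)
    (w : Fin 4 → ℝ) (hw : w ≠ 0) (hw0 : w 0 = 0) (g : ℝ) (hwA : w ᵥ* A = g • w)
    (hwv : w ⬝ᵥ v = 0) : g < m := by
  by_contra hlt
  push Not at hlt
  have hpos := pos_of_irr A hA hI v hv hne m he
  set p : Fin 4 → ℝ := fun k => max (w k) 0 with hp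
  have hp0 : ∀ k, 0 ≤ p k := fun k => le_max_right _ _
  have hpw : ∀ k, w k ≤ p k := fun k => le_max_left _ _
  -- the vector p A - g p is nonnegative
  have hG : ∀ k, 0 ≤ (p ᵥ* A) k - g * p k := by
    intro k
    have hk := congrFun hwA k
    simp only [Matrix.vecMul, dotProduct, Pi.smul_apply, smul_eq_mul] at hk ⊢
    rcases le_or_gt (w k) 0 with h | h
    · have hpk : p k = 0 := max_eq_right h
      rw [hpk, mul_zero, sub_zero]
      apply Finset.sum_nonneg
      intro l _
      by_cases hl : l = k
      · subst hl; simp [hpk]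
      · exact mul_nonneg (hp0 l) (hA _ _ hl)
    · have hpk : p k = w k := max_eq_left h.le
      rw [hpk, ← hk, sub_nonneg]
      apply Finset.sum_le_sum
      intro l _
      by_cases hl : l = k
      · subst hl; rw [hpk]
      · exact mul_le_mul_of_nonneg_right (hpw l) (hA _ _ hl)
  have hsum : ∑ k, ((p ᵥ* A) k - g * p k) * v k = (m - g) * ∑ k, p k * v k := by
    have h1 : (p ᵥ* A) ⬝ᵥ v = m * (p ⬝ᵥ v) := by
      rw [← Matrix.dotProduct_mulVec, he, dotProduct_smul, smul_eq_mul]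
    simp only [dotProduct] at h1
    simp only [sub_mul, Finset.sum_sub_distrib, h1, Finset.mul_sum, mul_assoc]
  have hz : ∀ k, ((p ᵥ* A) k - g * p k) * v k = 0 := by
    have hn : ∀ k ∈ Finset.univ, 0 ≤ ((p ᵥ* A) k - g * p k) * v k :=
      fun k _ => mul_nonneg (hG k) (hv k)
    have h0 : ∑ k, ((p ᵥ* A) k - g * p k) * v k = 0 := by
      apply le_antisymm _ (Finset.sum_nonneg hn)
      rw [hsum]
      exact mul_nonpos_of_nonpos_of_nonneg (by linarith)
        (Finset.sum_nonneg fun k _ => mul_nonneg (hp0 k) (hv k))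
    exact fun k => (Finset.sum_eq_zero_iff_of_nonneg hn).1 h0 k (Finset.mem_univ _)
  have hA0 : ∀ l k, 0 < w l → w k ≤ 0 → 0 < v k → A l k = 0 := by
    intro l k hl hk hvk
    have h1 := hz k
    have hpk : p k = 0 := max_eq_right hk
    have h2 : (p ᵥ* A) k = 0 := by
      rcases mul_eq_zero.1 h1 with h | h
      · rw [hpk] at h; linarith
      · exact absurd h hvk.ne'
    simp only [Matrix.vecMul, dotProduct] at h2
    have hn : ∀ j ∈ Finset.univ, 0 ≤ p j * A j k := by
      intro j _
      by_cases hj : j = k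
      · subst hj; simp [hpk]
      · exact mul_nonneg (hp0 j) (hA _ _ hj)
    have h3 := (Finset.sum_eq_zero_iff_of_nonneg hn).1 h2 l (Finset.mem_univ _)
    rcases mul_eq_zero.1 h3 with h | h
    · exact absurd (hpw l) (by rw [h]; linarith)
    · exact h
  simp only [dotProduct] at hwv
  have hex : ∃ l, 0 < w l := by
    by_contra hh
    push Not at hh
    apply hw
    ext k
    by_cases hk : k = 0
    · rw [hk, hw0]; rfl
    · have hn : ∀ j ∈ Finset.univ, w j * v j ≤ 0 :=
        fun j _ => mul_nonpos_of_nonpos_of_nonneg (hh j) (hv j)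
      have := (Finset.sum_eq_zero_iff_of_nonpos hn).1 hwv k (Finset.mem_univ _)
      rcases mul_eq_zero.1 this with h | h
      · exact h
      · exact absurd h (hpos k hk).ne'
  have hex' : ∃ l, w l < 0 := by
    by_contra hh
    push Not at hh
    apply hw
    ext k
    by_cases hk : k = 0
    · rw [hk, hw0]; rfl
    · have hn : ∀ j ∈ Finset.univ, 0 ≤ w j * v j :=
        fun j _ => mul_nonneg (hh j) (hv j)
      have := (Finset.sum_eq_zero_iff_of_nonneg hn).1 hwv k (Finset.mem_univ _)
      rcases mul_eq_zero.1 this with h | h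
      · exact h
      · exact absurd h (hpos k hk).ne'
  obtain ⟨l, hl⟩ := hex
  obtain ⟨n, hn⟩ := hex'
  have hl0 : l ≠ 0 := by rintro rfl; linarith
  have hn0 : n ≠ 0 := by rintro rfl; linarith
  rcases (hv 0).lt_or_eq with h0 | h0
  · have hS := hI (Finset.univ.filter (fun k => w k ≤ 0)) (by
      intro i hi k hk
      simp at hi hk
      refine hA0 i k hi hk ?_
      by_cases hk0 : k = 0
      · rw [hk0]; exact h0
      · exact hpos k hk0)
    rcases hS with h | h | h
    · have : n ∈ Finset.univ.filter (fun k => w k ≤ 0) := by simpa using hn.le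
      rw [h] at this; simp at this
    · have : l ∈ Finset.univ.filter (fun k => w k ≤ 0) := by rw [h]; simp
      simp at this; linarith
    · have : (0 : Fin 4) ∈ Finset.univ.filter (fun k => w k ≤ 0) := by simp [hw0]
      rw [h] at this; simp at this
  · have hS := hI (Finset.univ.filter (fun k => w k ≤ 0 ∧ k ≠ 0)) (by
      intro i hi k hk
      simp only [Finset.mem_filter, Finset.mem_univ, true_and, not_and, not_not] at hi hk
      by_cases hi0 : i = 0
      · rw [hi0]; exact zero_of_supp A hA v hv m he 0 k h0.symm (hpos k hk.2)
      · refine hA0 i k ?_ hk.1 (hpos k hk.2)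
        by_contra hh
        exact hi0 (hi (not_lt.1 hh)))
    rcases hS with h | h | h
    · have : n ∈ Finset.univ.filter (fun k => w k ≤ 0 ∧ k ≠ 0) := by simpa using ⟨hn.le, hn0⟩
      rw [h] at this; simp at this
    · have : l ∈ Finset.univ.filter (fun k => w k ≤ 0 ∧ k ≠ 0) := by rw [h]; simp
      simp at this; linarith [this.1]
    · have : l ∈ Finset.univ.filter (fun k => w k ≤ 0 ∧ k ≠ 0) := by rw [h]; simpa using hl0
      simp at this; linarith [this.1]

lemma dim2_core (A : Matrix (Fin 4) (Fin 4) ℝ) (hA : ∀ i j, i ≠ j → 0 ≤ A i j) (hI : Irr0 A)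
    (T : Matrix (Fin 4) (Fin 4) ℝ) (hT : ∀ i j, 0 ≤ T i j) (hd : T.det ≠ 0)
    (a p q f r x α y β γ : ℝ) (hp : 0 ≤ p) (hq : 0 ≤ q) (hf : 0 ≤ f) (hx : 0 ≤ x)
    (he : A * T = T * !![a, p, q, f; 1, r, x, α; 0, 1, y, β; 0, 0, 0, γ])
    (hT0 : T 0 0 = 1) (hT1 : ∀ l, l ≠ 0 → T l 0 = 0) (k : Fin 4) (hk : k ≠ 0) (hTk : T k 2 = 0) :
    Good A := by
  obtain ⟨l, l0, l1, l2, m1, m2, m3, hl⟩ := perron3 a p q 1 r x 0 1 y hp hq zero_le_one hx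
    le_rfl zero_le_one
  set c1 := (l - r) * (l - y) - x with hc1
  set c2 := l - y with hc2
  have c1n : 0 ≤ c1 := by linarith
  have c2n : 0 ≤ c2 := by linarith
  have hM : !![a, p, q, f; 1, r, x, α; 0, 1, y, β; 0, 0, 0, γ] *ᵥ ![c1, c2, 1, 0]
      = l • ![c1, c2, 1, 0] := by
    ext i
    fin_cases i <;> simp [Matrix.mulVec, dotProduct, Fin.sum_univ_four, hc1, hc2]
    · linear_combination -hl
    · ring
  set v := T *ᵥ ![c1, c2, 1, 0] with hv
  have hvk : ∀ i, v i = T i 0 * c1 + T i 1 * c2 + T i 2 := fun i => by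
    simp [hv, Matrix.mulVec, dotProduct, Fin.sum_univ_four]
  have hvn : ∀ i, 0 ≤ v i := fun i => by
    rw [hvk]; have := hT i 0; have := hT i 1; have := hT i 2; positivity
  have hu : IsUnit T.det := hd.isUnit
  have hinv : T⁻¹ * T = 1 := Matrix.nonsing_inv_mul _ hu
  have hinv' : T * T⁻¹ = 1 := Matrix.mul_nonsing_inv _ hu
  have hev : A *ᵥ v = l • v := by
    rw [hv, Matrix.mulVec_mulVec, he, ← Matrix.mulVec_mulVec, hM, Matrix.mulVec_smul]
  have hTv : T⁻¹ *ᵥ v = ![c1, c2, 1, 0] := by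
    rw [hv, Matrix.mulVec_mulVec, hinv, Matrix.one_mulVec]
  have hvne : v ≠ 0 := by
    intro h
    rw [h, Matrix.mulVec_zero] at hTv
    have := congrFun hTv 2
    simp at this
  have hpos := pos_of_irr A hA hI v hvn hvne l hev
  have hc2p : 0 < c2 := by
    have := hpos k hk
    rw [hvk, hT1 k hk, hTk] at this
    rcases c2n.lt_or_eq with h | h
    · exact h
    · rw [← h] at this; simp at this
  have hgap : γ < l := by
    refine gap A hA hI v hvn hvne l hev (T⁻¹ 3) ?_ ?_ γ ?_ ?_
    · intro h
      have := congrFun (congrFun hinv 3) 3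
      simp [Matrix.mul_apply, h] at this
    · have := congrFun (congrFun hinv 3) 0
      simp [Matrix.mul_apply, Fin.sum_univ_four, hT0, hT1 1, hT1 2, hT1 3] at this
      exact this
    · have h : T⁻¹ * A = !![a, p, q, f; 1, r, x, α; 0, 1, y, β; 0, 0, 0, γ] * T⁻¹ := by
        calc T⁻¹ * A = T⁻¹ * (A * T) * T⁻¹ := by
              rw [Matrix.mul_assoc, Matrix.mul_assoc, hinv', Matrix.mul_one]
          _ = _ := by rw [he, ← Matrix.mul_assoc, hinv, Matrix.one_mul]
      ext j
      have := congrFun (congrFun h 3) j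
      simp [Matrix.mul_apply, Fin.sum_univ_four] at this
      simp [Matrix.vecMul, dotProduct, Fin.sum_univ_four]
      exact this
    · have := congrFun hTv 3
      simpa [Matrix.mulVec] using this
  set d := l - γ with hdd
  have dpos : 0 < d := by linarith
  set N := |α| / (d * c2) + |β| / d with hN
  have hNn : 0 ≤ N := by positivity
  have hα : 0 ≤ α + N * d * c2 := by
    have e1 : N * d * c2 = |α| + |β| * c2 := by rw [hN]; field_simp
    have := neg_abs_le α
    have : 0 ≤ |β| * c2 := by positivity
    linarith
  have hβ : 0 ≤ β + N * d := by
    have e1 : N * d = |α| / c2 + |β| := by rw [hN]; field_simp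
    have := neg_abs_le β
    have : 0 ≤ |α| / c2 := by positivity
    linarith
  refine ⟨T * !![1, 0, 0, N * c1; 0, 1, 0, N * c2; 0, 0, 1, N; 0, 0, 0, 1],
    !![a, p, q, f + N * d * c1; 1, r, x, α + N * d * c2; 0, 1, y, β + N * d; 0, 0, 0, γ],
    ?_, ?_, ?_, ?_, by simp, by simp, by simp⟩
  · intro i j
    have := hT i 0; have := hT i 1; have := hT i 2; have := hT i 3
    fin_cases j <;> simp [Matrix.mul_apply, Fin.sum_univ_four, hT]
    positivity
  · rw [Matrix.det_mul]
    refine mul_ne_zero hd ?_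
    simp [Matrix.det_succ_row_zero, Fin.sum_univ_succ, Fin.succAbove]
  · rw [← Matrix.mul_assoc, he, Matrix.mul_assoc, Matrix.mul_assoc]
    congr 1
    have E0 := congrFun hM 0
    have E1 := congrFun hM 1
    have E2 := congrFun hM 2
    simp [Matrix.mulVec, dotProduct, Fin.sum_univ_four] at E0 E1 E2
    ext i j
    fin_cases i <;> fin_cases j <;> simp [Matrix.mul_apply, Fin.sum_univ_four]
    · rw [hdd]; linear_combination N * E0
    · rw [hdd]; linear_combination N * E1
    · rw [hdd]; linear_combination N * E2
  · have : 0 ≤ f + N * d * c1 := by positivity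
    intro i j hij
    fin_cases i <;> fin_cases j <;> simp [hp, hq, hx, hα, hβ, this] at hij ⊢

lemma dim2 (A : Matrix (Fin 4) (Fin 4) ℝ) (hA : ∀ i j, i ≠ j → 0 ≤ A i j) (hI : Irr0 A)
    (B : Matrix (Fin 3) (Fin 3) ℝ) (hB : B = A.submatrix Fin.succ Fin.succ)
    (b : Fin 3 → ℝ) (hb : b = fun i => A i.succ 0)
    (hK : (Matrix.of (fun i (j : Fin 3) => ((B ^ (j : ℕ)) *ᵥ b) i)).det = 0)
    (hnp : ¬ ∃ ρ : ℝ, B *ᵥ b = ρ • b) : Good A := by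
  have hBM : ∀ i j, i ≠ j → 0 ≤ B i j := fun i j h => by
    rw [hB]; exact hA _ _ (fun h' => h (Fin.succ_injective _ h'))
  have hbn : ∀ i, 0 ≤ b i := fun i => by
    rw [hb]; exact hA _ _ (Fin.succ_ne_zero i)
  have hb0 : b ≠ 0 := by
    intro h; exact hnp ⟨0, by simp [h]⟩
  obtain ⟨σ, τ, hst⟩ : ∃ σ τ : ℝ, B *ᵥ (B *ᵥ b) = σ • (B *ᵥ b) + τ • b := by
    obtain ⟨z, hz, hz0⟩ := Matrix.exists_mulVec_eq_zero_iff.2 hK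
    have e : ∀ i, b i * z 0 + (B *ᵥ b) i * z 1 + (B *ᵥ (B *ᵥ b)) i * z 2 = 0 := fun i => by
      have h := congrFun hz0 i
      rw [Matrix.mulVec, dotProduct, Fin.sum_univ_three] at h
      have h' : ((B ^ (0 : ℕ)) *ᵥ b) i * z 0 + ((B ^ (1 : ℕ)) *ᵥ b) i * z 1
        + ((B ^ (2 : ℕ)) *ᵥ b) i * z 2 = 0 := h
      rw [pow_zero, pow_one, Matrix.one_mulVec, pow_two, ← Matrix.mulVec_mulVec] at h'
      exact h'
    have z2 : z 2 ≠ 0 := by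
      intro h2
      by_cases h1 : z 1 = 0
      · by_cases h0 : z 0 = 0
        · apply hz; ext i; fin_cases i <;> simp [h0, h1, h2]
        · apply hb0; ext i
          have := e i
          simp [h1, h2, h0] at this
          exact this
      · apply hnp
        refine ⟨-z 0 / z 1, ?_⟩
        ext i
        have := e i
        simp only [h2, mul_zero, add_zero] at this
        simp only [Pi.smul_apply, smul_eq_mul]
        field_simp
        linarith
    refine ⟨-z 1 / z 2, -z 0 / z 2, ?_⟩
    ext i
    have := e i
    simp only [Pi.add_apply, Pi.smul_apply, smul_eq_mul]
    field_simp
    linarith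
  obtain ⟨k, r, hk, hrk, hr⟩ : ∃ k r, 0 < b k ∧ (B *ᵥ b) k = r * b k ∧
      ∀ i, r * b i ≤ (B *ᵥ b) i := by
    have hne : (Finset.univ.filter (fun i => 0 < b i)).Nonempty := by
      by_contra h
      rw [Finset.not_nonempty_iff_eq_empty] at h
      apply hb0; ext i
      by_contra hi
      have : i ∈ Finset.univ.filter (fun i => 0 < b i) := by
        simp; exact lt_of_le_of_ne (hbn i) (Ne.symm hi)
      rw [h] at this; simp at this
    obtain ⟨k, hk, hmin⟩ := Finset.exists_min_image _ (fun i => (B *ᵥ b) i / b i) hne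
    simp at hk
    refine ⟨k, (B *ᵥ b) k / b k, hk, by field_simp, ?_⟩
    intro i
    rcases (hbn i).lt_or_eq with h | h
    · have := hmin i (by simpa using h)
      rwa [le_div_iff₀ h] at this
    · rw [← h, mul_zero]
      simp only [Matrix.mulVec, dotProduct]
      apply Finset.sum_nonneg
      intro j _
      by_cases hj : i = j
      · subst hj; rw [← h, mul_zero]
      · exact mul_nonneg (hBM _ _ hj) (hbn j)
  set t : Fin 3 → ℝ := B *ᵥ b - r • b with ht
  have htn : ∀ i, 0 ≤ t i := fun i => by simp [ht, hr]
  have htk : t k = 0 := by simp [ht, hrk]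
  have hBb : B *ᵥ b = r • b + t := by rw [ht]; abel
  have hBt : B *ᵥ t = (τ + (σ - r) * r) • b + (σ - r) • t := by
    rw [ht, Matrix.mulVec_sub, hst, Matrix.mulVec_smul]
    ext i; simp; ring
  clear_value t
  set x := τ + (σ - r) * r with hx
  set y := σ - r with hy
  have hxn : 0 ≤ x := by
    have h1 := congrFun hBt k
    simp only [Pi.add_apply, Pi.smul_apply, smul_eq_mul, htk, mul_zero, add_zero] at h1
    have h2 : 0 ≤ (B *ᵥ t) k := by
      simp only [Matrix.mulVec, dotProduct]
      apply Finset.sum_nonneg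
      intro j _
      by_cases hj : k = j
      · subst hj; rw [htk, mul_zero]
      · exact mul_nonneg (hBM _ _ hj) (htn j)
    rw [h1] at h2
    exact nonneg_of_mul_nonneg_left h2 hk
  clear_value x y
  have htne : t ≠ 0 := by
    intro h; exact hnp ⟨r, by rw [hBb, h, add_zero]⟩
  obtain ⟨j, hj⟩ : ∃ j : Fin 3,
      (!![b 0, t 0, (Pi.single j 1 : Fin 3 → ℝ) 0; b 1, t 1, (Pi.single j 1 : Fin 3 → ℝ) 1;
        b 2, t 2, (Pi.single j 1 : Fin 3 → ℝ) 2]).det ≠ 0 := by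
    by_contra hh
    push Not at hh
    apply htne
    have h0 := hh 0
    have h1 := hh 1
    have h2 := hh 2
    simp [Matrix.det_fin_three, Pi.single_apply] at h0 h1 h2
    ext i
    have := hk.ne'
    fin_cases k <;> fin_cases i <;> simp at htk this ⊢ <;> simp_all
  obtain ⟨g, hg⟩ : ∃ g : Fin 3 → ℝ, !![b 0, t 0, (Pi.single j 1 : Fin 3 → ℝ) 0;
      b 1, t 1, (Pi.single j 1 : Fin 3 → ℝ) 1;
        b 2, t 2, (Pi.single j 1 : Fin 3 → ℝ) 2] *ᵥ g = B *ᵥ (Pi.single j 1) := by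
    refine ⟨(!![b 0, t 0, (Pi.single j 1 : Fin 3 → ℝ) 0;
      b 1, t 1, (Pi.single j 1 : Fin 3 → ℝ) 1;
        b 2, t 2, (Pi.single j 1 : Fin 3 → ℝ) 2])⁻¹ *ᵥ (B *ᵥ (Pi.single j 1)), ?_⟩
    rw [Matrix.mulVec_mulVec, Matrix.mul_nonsing_inv _ hj.isUnit, Matrix.one_mulVec]
  have hu : ∀ i, 0 ≤ (Pi.single j 1 : Fin 3 → ℝ) i := fun i => by
    by_cases h : i = j <;> simp [Pi.single_apply, h]
  generalize (Pi.single j 1 : Fin 3 → ℝ) = u at *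
  have rowpos : ∀ z : Fin 3 → ℝ, (∀ i, 0 ≤ z i) → 0 ≤ A 0 1 * z 0 + A 0 2 * z 1 + A 0 3 * z 2 := by
    intro z hz
    have := hz 0; have := hz 1; have := hz 2
    have r1 : 0 ≤ A 0 1 := hA _ _ (by decide)
    have r2 : 0 ≤ A 0 2 := hA _ _ (by decide)
    have r3 : 0 ≤ A 0 3 := hA _ _ (by decide)
    positivity
  have hTk : ∀ i : Fin 3, !![1, 0, 0, 0; 0, b 0, t 0, u 0; 0, b 1, t 1, u 1; 0, b 2, t 2, u 2]
      i.succ 2 = t i := by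
    intro i; fin_cases i <;> rfl
  refine dim2_core A hA hI
    !![1, 0, 0, 0; 0, b 0, t 0, u 0; 0, b 1, t 1, u 1; 0, b 2, t 2, u 2] ?_ ?_
    (A 0 0) _ _ _ r x (g 0) y (g 1) (g 2) (rowpos b hbn) (rowpos t htn) (rowpos u hu) hxn ?_ rfl ?_
    k.succ (Fin.succ_ne_zero k) ((hTk k).trans htk)
  · intro i j
    fin_cases i <;> fin_cases j <;> simp [hbn, htn, hu]
  · rw [Matrix.det_fin_three] at hj
    simp at hj
    simp [Matrix.det_succ_row_zero, Fin.sum_univ_succ, Fin.succAbove]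
    intro h
    apply hj
    linarith
  · have e1 := fun i => congrFun hBb i
    have e2 := fun i => congrFun hBt i
    have e3 := fun i => congrFun hg i
    have eb := fun i => congrFun hb i
    simp [hB, Matrix.mulVec, dotProduct, Fin.sum_univ_three] at e1 e2
    have e30 := e3 0
    have e31 := e3 1
    have e32 := e3 2
    simp [hB, Matrix.mulVec, dotProduct, Fin.sum_univ_three] at e30 e31 e32
    have e10 := e1 0
    have e11 := e1 1
    have e12 := e1 2
    have e20 := e2 0
    have e21 := e2 1
    have e22 := e2 2
    have b0 := eb 0
    have b1 := eb 1
    have b2 := eb 2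
    simp at e10 e11 e12 e20 e21 e22 b0 b1 b2
    ext i j
    fin_cases i <;> fin_cases j <;> simp [Matrix.mul_apply, Fin.sum_univ_four] <;> linarith
  · intro l hl
    fin_cases l <;> simp at hl ⊢

lemma cyc_good (A : Matrix (Fin 4) (Fin 4) ℝ) (hA : ∀ i j, i ≠ j → 0 ≤ A i j)
    (B : Matrix (Fin 3) (Fin 3) ℝ) (hB : B = A.submatrix Fin.succ Fin.succ)
    (b : Fin 3 → ℝ) (hb : b = fun i => A i.succ 0)
    (hK : (Matrix.of (fun i (j : Fin 3) => ((B ^ (j : ℕ)) *ᵥ b) i)).det ≠ 0) : Good A := by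
  set σ := Tuple.sort (fun i => B i i) with hσ
  have hmono := Tuple.monotone_sort (fun i => B i i)
  rw [← hσ] at hmono
  set σ4 : Equiv.Perm (Fin 4) := Equiv.Perm.decomposeFin.symm (0, σ) with hσ4
  have s0 : σ4 0 = 0 := by simp [hσ4]
  have ss : ∀ i : Fin 3, σ4 i.succ = (σ i).succ := fun i => by simp [hσ4]
  apply good_perm A σ4
  have hA' : ∀ i j, i ≠ j → 0 ≤ (A.submatrix σ4 σ4) i j := fun i j h =>
    hA _ _ (fun h' => h (σ4.injective h'))
  have hpow : ∀ n : ℕ, (B.submatrix σ σ) ^ n = (B ^ n).submatrix σ σ := by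
    intro n
    induction n with
    | zero => simp
    | succ n ih => rw [pow_succ, pow_succ, ih, Matrix.submatrix_mul_equiv]
  obtain ⟨T, H, hT, hd, he, hH, h20, hc⟩ := cyc3 (B.submatrix σ σ) (fun i j h => by
      rw [hB]; exact hA _ _ (fun h' => h (σ.injective (Fin.succ_injective _ h'))))
    (b ∘ σ) (fun i => by rw [hb]; exact hA _ _ (Fin.succ_ne_zero _))
    (hmono (by decide : (0 : Fin 3) ≤ 1)) (hmono (by decide : (1 : Fin 3) ≤ 2)) (by
      have : (Matrix.of (fun i (j : Fin 3) => (((B.submatrix σ σ) ^ (j : ℕ)) *ᵥ (b ∘ σ)) i))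
        = (Matrix.of (fun i (j : Fin 3) => ((B ^ (j : ℕ)) *ᵥ b) i)).submatrix σ id := by
        ext i j
        simp only [Matrix.of_apply, Matrix.submatrix_apply, id, hpow, Matrix.mulVec, dotProduct,
          Function.comp]
        exact Equiv.sum_comp σ (fun x => (B ^ (j : ℕ)) (σ i) x * b x)
      rw [this, Matrix.det_permute]
      refine mul_ne_zero ?_ hK
      rcases Int.units_eq_one_or (Equiv.Perm.sign σ) with h | h <;> simp [h])
  refine lift3 _ hA' T H hT hd ?_ hH h20 1 zero_le_one ?_
  · rw [← he, hB]
    congr 1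
  · intro i
    simp [hc, ss, s0, hb]

/-- Either done, or `b` is an eigenvector of the lower block. -/
lemma step0 (A : Matrix (Fin 4) (Fin 4) ℝ) (hA : ∀ i j, i ≠ j → 0 ≤ A i j) (hI : Irr0 A) :
    Good A ∨ ∃ ρ : ℝ, (A.submatrix Fin.succ Fin.succ) *ᵥ (fun i : Fin 3 => A i.succ 0)
      = ρ • (fun i : Fin 3 => A i.succ 0) := by
  by_cases hK : (Matrix.of (fun i (j : Fin 3) => (((A.submatrix Fin.succ Fin.succ) ^ (j : ℕ)) *ᵥ
      (fun i : Fin 3 => A i.succ 0)) i)).det = 0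
  · by_cases h : ∃ ρ : ℝ, (A.submatrix Fin.succ Fin.succ) *ᵥ (fun i : Fin 3 => A i.succ 0)
      = ρ • (fun i : Fin 3 => A i.succ 0)
    · exact Or.inr h
    · exact Or.inl (dim2 A hA hI _ rfl _ rfl hK h)
  · exact Or.inl (cyc_good A hA _ rfl _ rfl hK)

lemma col_ne (A : Matrix (Fin 4) (Fin 4) ℝ) (hI : Irr0 A) :
    (fun i : Fin 3 => A i.succ 0) ≠ 0 := by
  intro h
  have := hI {0} (by
    intro l hl k hk
    simp at hl hk
    subst hk
    obtain ⟨i, rfl⟩ := Fin.exists_succ_eq.2 hl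
    exact congrFun h i)
  revert this
  decide

lemma case31 (A : Matrix (Fin 4) (Fin 4) ℝ) (hA : ∀ i j, i ≠ j → 0 ≤ A i j) (hI : Irr0 A)
    (h0 : ∀ k, k ≠ 0 → A 0 k = 0) : Good A := by
  rcases step0 A hA hI with h | ⟨ρ, hρ⟩
  · exact h
  have hne := col_ne A hI
  have h01 := h0 1 (by decide)
  have h02 := h0 2 (by decide)
  have h03 := h0 3 (by decide)
  have e : ∀ i : Fin 3, A i.succ 1 * A 1 0 + A i.succ 2 * A 2 0 + A i.succ 3 * A 3 0
      = ρ * A i.succ 0 := by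
    intro i
    have := congrFun hρ i
    simpa [Matrix.mulVec, dotProduct, Fin.sum_univ_three] using this
  have hpos := pos_of_irr A hA hI ![0, A 1 0, A 2 0, A 3 0] (by
      intro i
      fin_cases i
      · exact le_refl _
      · exact hA _ _ (by decide)
      · exact hA _ _ (by decide)
      · exact hA _ _ (by decide)) (by
      intro h
      apply hne
      ext i
      have := congrFun h i.succ
      fin_cases i <;> simpa using this) ρ (by
      have e0 := e 0
      have e1 := e 1
      have e2 := e 2
      simp at e0 e1 e2
      ext i
      fin_cases i <;> simp [Matrix.mulVec, dotProduct, Fin.sum_univ_four, h01, h02, h03] <;>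
        linarith)
  obtain ⟨T, H, hT, hd, he, hH, h20, hc⟩ := hess3 (A.submatrix Fin.succ Fin.succ)
    (fun i j h => hA _ _ (fun h' => h (Fin.succ_injective _ h')))
  obtain ⟨c, hc0, hca⟩ := hc (fun i => A i.succ 0) ρ (by
    intro i
    have := hpos i.succ (Fin.succ_ne_zero i)
    fin_cases i <;> simpa using this) hρ
  have E : ∀ i j : Fin 3, A i.succ 1 * T 0 j + A i.succ 2 * T 1 j + A i.succ 3 * T 2 j
      = T i 0 * H 0 j + T i 1 * H 1 j + T i 2 * H 2 j := by
    intro i j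
    have := congrFun (congrFun he i) j
    simpa [Matrix.mul_apply, Fin.sum_univ_three] using this
  have C : ∀ i : Fin 3, T i 0 * c 0 + T i 1 * c 1 + T i 2 * c 2 = A i.succ 0 := by
    intro i
    have := congrFun hca i
    simpa [Matrix.mulVec, dotProduct, Fin.sum_univ_three] using this
  refine ⟨!![0, 0, 0, 1; T 0 0, T 0 1, T 0 2, 0; T 1 0, T 1 1, T 1 2, 0; T 2 0, T 2 1, T 2 2, 0],
    !![H 0 0, H 0 1, H 0 2, c 0; H 1 0, H 1 1, H 1 2, c 1; H 2 0, H 2 1, H 2 2, c 2;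
      0, 0, 0, A 0 0], ?_, ?_, ?_, ?_, ?_, rfl, rfl⟩
  · intro i j
    fin_cases i <;> fin_cases j <;> simp [hT]
  · rw [Matrix.det_fin_three] at hd
    simp [Matrix.det_succ_row_zero, Fin.sum_univ_succ, Fin.succAbove]
    intro h
    apply hd
    linarith
  · have E00 := E 0 0
    have E01 := E 0 1
    have E02 := E 0 2
    have E10 := E 1 0
    have E11 := E 1 1
    have E12 := E 1 2
    have E20 := E 2 0
    have E21 := E 2 1
    have E22 := E 2 2
    have C0 := C 0
    have C1 := C 1
    have C2 := C 2
    simp at E00 E01 E02 E10 E11 E12 E20 E21 E22 C0 C1 C2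
    ext i j
    fin_cases i <;> fin_cases j <;>
      simp [Matrix.mul_apply, Fin.sum_univ_four, h01, h02, h03] <;> linarith
  · intro i j hij
    fin_cases i <;> fin_cases j <;> simp [hc0] at hij ⊢ <;> exact hH _ _ (by decide)
  · simpa using h20

/-- Full irreducibility: no proper invariant coordinate subspace. -/
def Irr (A : Matrix (Fin 4) (Fin 4) ℝ) : Prop :=
  ∀ S : Finset (Fin 4), (∀ l, l ∉ S → ∀ k ∈ S, A l k = 0) → S = ∅ ∨ S = Finset.univ

lemma Irr.irr0 {A : Matrix (Fin 4) (Fin 4) ℝ} (h : Irr A) : Irr0 A := by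
  intro S hS
  rcases h S hS with h | h
  · exact Or.inl h
  · exact Or.inr (Or.inl h)

lemma inv_perm (A : Matrix (Fin 4) (Fin 4) ℝ) (σ : Equiv.Perm (Fin 4)) (S : Finset (Fin 4))
    (h : ∀ l, l ∉ S → ∀ k ∈ S, (A.submatrix σ σ) l k = 0) :
    ∀ l, l ∉ S.map σ.toEmbedding → ∀ k ∈ S.map σ.toEmbedding, A l k = 0 := by
  intro l hl k hk
  rw [Finset.mem_map_equiv] at hl hk
  simpa using h _ hl _ hk

lemma Irr.perm {A : Matrix (Fin 4) (Fin 4) ℝ} (h : Irr A) (σ : Equiv.Perm (Fin 4)) :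
    Irr (A.submatrix σ σ) := by
  intro S hS
  rcases h _ (inv_perm A σ S hS) with h | h
  · exact Or.inl (Finset.map_eq_empty.1 h)
  · right
    have := congrArg Finset.card h
    rw [Finset.card_map] at this
    exact (Finset.card_eq_iff_eq_univ S).1 (by rw [this, Finset.card_univ])

lemma Irr.pos {A : Matrix (Fin 4) (Fin 4) ℝ} (hI : Irr A) (hA : ∀ i j, i ≠ j → 0 ≤ A i j)
    (v : Fin 4 → ℝ) (hv : ∀ i, 0 ≤ v i) (hne : v ≠ 0) (m : ℝ) (he : A *ᵥ v = m • v) :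
    ∀ k, 0 < v k := by
  have := hI (Finset.univ.filter (fun k => 0 < v k)) (by
    intro l hl k hk
    simp at hl hk
    exact zero_of_supp A hA v hv m he l k (le_antisymm hl (hv l)) hk)
  rcases this with h | h
  · exfalso
    apply hne
    ext i
    have hi : i ∉ Finset.univ.filter (fun k => 0 < v k) := by rw [h]; simp
    simp at hi
    exact le_antisymm hi (hv i)
  · intro k
    have : k ∈ Finset.univ.filter (fun k => 0 < v k) := by rw [h]; simp
    simpa using this

lemma minratio (v v' : Fin 4 → ℝ) (hv' : ∀ i, 0 < v' i) :
    ∃ t i, v i = t * v' i ∧ ∀ j, t * v' j ≤ v j := by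
  obtain ⟨i, -, hi⟩ := Finset.exists_min_image Finset.univ (fun i => v i / v' i) ⟨0, by simp⟩
  refine ⟨v i / v' i, i, ?_, ?_⟩
  · have := (hv' i).ne'
    field_simp
  · intro j
    have := hi j (by simp)
    rwa [le_div_iff₀ (hv' j)] at this

lemma eig_le (A : Matrix (Fin 4) (Fin 4) ℝ) (hA : ∀ i j, i ≠ j → 0 ≤ A i j)
    (v v' : Fin 4 → ℝ) (hv : ∀ i, 0 < v i) (hv' : ∀ i, 0 < v' i) (m m' : ℝ)
    (he : A *ᵥ v = m • v) (he' : A *ᵥ v' = m' • v') : m' ≤ m := by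
  obtain ⟨t, i, hi, ht⟩ := minratio v v' hv'
  have h1 : 0 ≤ (A *ᵥ (v - t • v')) i := by
    simp only [Matrix.mulVec, dotProduct]
    apply Finset.sum_nonneg
    intro j _
    by_cases hj : i = j
    · subst hj
      simp [hi]
    · exact mul_nonneg (hA _ _ hj) (by simp [ht])
  rw [Matrix.mulVec_sub, Matrix.mulVec_smul, he, he'] at h1
  simp only [Pi.sub_apply, Pi.smul_apply, smul_eq_mul] at h1
  have h2 : 0 ≤ (m - m') * v i := by
    have : t * (m' * v' i) = m' * v i := by rw [hi]; ring
    linarith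
  have := nonneg_of_mul_nonneg_left h2 (hv i)
  linarith

lemma eig_prop (A : Matrix (Fin 4) (Fin 4) ℝ) (hA : ∀ i j, i ≠ j → 0 ≤ A i j) (hI : Irr A)
    (v v' : Fin 4 → ℝ) (hv : ∀ i, 0 < v i) (hv' : ∀ i, 0 < v' i) (m m' : ℝ)
    (he : A *ᵥ v = m • v) (he' : A *ᵥ v' = m' • v') (i j : Fin 4) : v i * v' j = v j * v' i := by
  have hm : m' = m := le_antisymm (eig_le A hA v v' hv hv' m m' he he')
    (eig_le A hA v' v hv' hv m' m he' he)
  subst hm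
  obtain ⟨t, k, hk, ht⟩ := minratio v v' hv'
  by_cases h : v - t • v' = 0
  · have : ∀ l, v l = t * v' l := fun l => by
      have := congrFun h l
      simp at this
      linarith
    rw [this i, this j]
    ring
  · have := hI.pos hA (v - t • v') (fun l => by simp [ht]) h m' (by
      rw [Matrix.mulVec_sub, Matrix.mulVec_smul, he, he', smul_sub, smul_comm]) k
    simp [hk] at this

lemma step_eig0 (A : Matrix (Fin 4) (Fin 4) ℝ) (hA : ∀ i j, i ≠ j → 0 ≤ A i j) (hI : Irr A) :
    Good A ∨ ∃ (v : Fin 4 → ℝ) (m : ℝ), (∀ i, 0 < v i) ∧ A *ᵥ v = m • v ∧ ∀ l, l ≠ 0 → v l = A l 0 := by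
  rcases step0 A hA hI.irr0 with h | ⟨ρ, hρ⟩
  · exact Or.inl h
  right
  have hne := col_ne A hI.irr0
  have e : ∀ i : Fin 3, A i.succ 1 * A 1 0 + A i.succ 2 * A 2 0 + A i.succ 3 * A 3 0
      = ρ * A i.succ 0 := by
    intro i
    have := congrFun hρ i
    simpa [Matrix.mulVec, dotProduct, Fin.sum_univ_three] using this
  have e0 := e 0
  have e1 := e 1
  have e2 := e 2
  simp at e0 e1 e2
  have n10 := hA 1 0 (by decide)
  have n20 := hA 2 0 (by decide)
  have n30 := hA 3 0 (by decide)
  have n01 := hA 0 1 (by decide)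
  have n02 := hA 0 2 (by decide)
  have n03 := hA 0 3 (by decide)
  obtain ⟨m, hm1, hm2, hm⟩ := root2 (A 0 0) ρ (A 0 1 * A 1 0 + A 0 2 * A 2 0 + A 0 3 * A 3 0)
    (by positivity)
  have he : A *ᵥ ![m - ρ, A 1 0, A 2 0, A 3 0] = m • ![m - ρ, A 1 0, A 2 0, A 3 0] := by
    ext i
    fin_cases i <;> simp [Matrix.mulVec, dotProduct, Fin.sum_univ_four] <;> linarith
  refine ⟨![m - ρ, A 1 0, A 2 0, A 3 0], m, hI.pos hA _ ?_ ?_ m he, he, ?_⟩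
  · intro i
    fin_cases i <;> simp [n10, n20, n30, hm2]
  · intro h
    apply hne
    ext i
    have := congrFun h i.succ
    fin_cases i <;> simpa using this
  · intro l hl
    fin_cases l <;> simp at hl ⊢

lemma step_eig (A : Matrix (Fin 4) (Fin 4) ℝ) (hA : ∀ i j, i ≠ j → 0 ≤ A i j) (hI : Irr A)
    (k : Fin 4) :
    Good A ∨ ∃ (v : Fin 4 → ℝ) (m : ℝ), (∀ i, 0 < v i) ∧ A *ᵥ v = m • v ∧ ∀ l, l ≠ k → v l = A l k := by
  set σ := Equiv.swap 0 k with hσ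
  have s0 : σ 0 = k := by simp [hσ]
  rcases step_eig0 (A.submatrix σ σ) (fun i j h => hA _ _ (fun h' => h (σ.injective h')))
    (hI.perm σ) with h | ⟨v, m, hv, he, hl⟩
  · exact Or.inl (good_perm A σ h)
  right
  refine ⟨v ∘ σ.symm, m, fun i => hv _, ?_, ?_⟩
  · ext i
    have := congrFun he (σ.symm i)
    simp only [Matrix.mulVec, dotProduct, Matrix.submatrix_apply, Equiv.apply_symm_apply,
      Pi.smul_apply, Function.comp] at this ⊢
    rw [← this, ← Equiv.sum_comp σ]
    simp
  · intro l hlk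
    have : σ.symm l ≠ 0 := by
      intro h
      apply hlk
      rw [← s0, ← h, Equiv.apply_symm_apply]
    have := hl _ this
    simpa [s0] using this

lemma irr_case (A : Matrix (Fin 4) (Fin 4) ℝ) (hA : ∀ i j, i ≠ j → 0 ≤ A i j) (hI : Irr A) :
    Good A := by
  rcases step_eig A hA hI 0 with h | ⟨v, m, hv, he, hl⟩
  · exact h
  rcases step_eig A hA hI 2 with h | ⟨v2, m2, hv2, he2, hl2⟩
  · exact h
  rcases step_eig A hA hI 3 with h | ⟨v3, m3, hv3, he3, hl3⟩
  · exact h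
  have p2 := eig_prop A hA hI v v2 hv hv2 m m2 he he2 1 3
  have p3 := eig_prop A hA hI v v3 hv hv3 m m3 he he3 1 2
  have b1 := hl 1 (by decide)
  have b2 := hl 2 (by decide)
  have b3 := hl 3 (by decide)
  rw [b1, b3, hl2 1 (by decide), hl2 3 (by decide)] at p2
  rw [b1, b2, hl3 1 (by decide), hl3 2 (by decide)] at p3
  have hpos := hv 1
  rw [b1] at hpos
  have hne := hpos.ne'
  have f1 := congrFun he 1
  have f2 := congrFun he 2
  have f3 := congrFun he 3
  simp only [Matrix.mulVec, dotProduct, Fin.sum_univ_four, b1, b2, b3, Pi.smul_apply,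
    smul_eq_mul] at f1 f2 f3
  have n12 := hA 1 2 (by decide)
  have n13 := hA 1 3 (by decide)
  have n10 := hA 1 0 (by decide)
  have n20 := hA 2 0 (by decide)
  have n30 := hA 3 0 (by decide)
  have n01 := hA 0 1 (by decide)
  have n02 := hA 0 2 (by decide)
  have n03 := hA 0 3 (by decide)
  have q0 : 0 ≤ A 0 1 * A 1 0 + A 0 2 * A 2 0 + A 0 3 * A 3 0 := by positivity
  have q2 : 0 ≤ A 1 2 / A 1 0 := by positivity
  have q3 : 0 ≤ A 1 3 / A 1 0 := by positivity
  refine ⟨!![1, 0, 0, 0; 0, A 1 0, 0, 0; 0, A 2 0, 1, 0; 0, A 3 0, 0, 1],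
    !![A 0 0, A 0 1 * A 1 0 + A 0 2 * A 2 0 + A 0 3 * A 3 0, A 0 2, A 0 3;
      1, m - v 0, A 1 2 / A 1 0, A 1 3 / A 1 0;
      0, 0, A 2 2 - A 1 2 * A 2 0 / A 1 0, 0;
      0, 0, 0, A 3 3 - A 1 3 * A 3 0 / A 1 0], ?_, ?_, ?_, ?_, rfl, rfl, rfl⟩
  · intro i j
    fin_cases i <;> fin_cases j <;> simp [n10, n20, n30]
  · simp [Matrix.det_succ_row_zero, Fin.sum_univ_succ, Fin.succAbove, hne]
  · ext i j
    fin_cases i <;> fin_cases j <;> simp [Matrix.mul_apply, Fin.sum_univ_four] <;>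
      field_simp <;> linarith
  · intro i j hij
    fin_cases i <;> fin_cases j <;> simp [q0, q2, q3, n02, n03] at hij ⊢

lemma good_all (A : Matrix (Fin 4) (Fin 4) ℝ) (hA : ∀ i j, i ≠ j → 0 ≤ A i j) : Good A := by
  have hAp : ∀ σ : Equiv.Perm (Fin 4), ∀ i j, i ≠ j → 0 ≤ (A.submatrix σ σ) i j :=
    fun σ i j h => hA _ _ (fun h' => h (σ.injective h'))
  by_cases hN : ∃ S : Finset (Fin 4), (∀ l, l ∉ S → ∀ k ∈ S, A l k = 0) ∧
      (S.card = 1 ∨ S.card = 2)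
  · obtain ⟨S, hS, hc | hc⟩ := hN
    · obtain ⟨k, rfl⟩ := Finset.card_eq_one.1 hc
      apply good_perm A (Equiv.swap 0 k)
      obtain ⟨T, H, hT, hd, he, hH, h20, -⟩ :=
        hess3 ((A.submatrix (Equiv.swap 0 k) (Equiv.swap 0 k)).submatrix Fin.succ Fin.succ)
        (fun i j h => hAp _ _ _ (fun h' => h (Fin.succ_injective _ h')))
      refine lift3 _ (hAp _) T H hT hd he hH h20 0 (le_refl _) ?_
      intro i
      rw [zero_mul]
      simp only [Matrix.submatrix_apply]
      refine hS _ ?_ _ (by simp)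
      rw [Finset.mem_singleton]
      intro h
      have h' : Equiv.swap 0 k i.succ = Equiv.swap 0 k 0 := by rw [h]; simp
      exact Fin.succ_ne_zero i ((Equiv.swap 0 k).injective h')
    · obtain ⟨i, j, hij, rfl⟩ := Finset.card_eq_two.1 hc
      obtain ⟨σ, s0, s1⟩ : ∃ σ : Equiv.Perm (Fin 4), σ 0 = i ∧ σ 1 = j := by
        refine ⟨Equiv.swap 0 i * Equiv.swap 1 (Equiv.swap 0 i j), ?_⟩
        clear hS hc
        revert i j
        decide
      apply good_perm A σ
      have z : ∀ l, l ≠ 0 → l ≠ 1 → A (σ l) i = 0 ∧ A (σ l) j = 0 := by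
        intro l h0 h1
        have hn : σ l ∉ ({i, j} : Finset (Fin 4)) := by
          simp only [Finset.mem_insert, Finset.mem_singleton, not_or]
          rw [← s0, ← s1]
          exact ⟨fun h => h0 (σ.injective h), fun h => h1 (σ.injective h)⟩
        exact ⟨hS _ hn _ (by simp), hS _ hn _ (by simp)⟩
      refine ⟨1, A.submatrix σ σ, ?_, by simp, by simp, hAp σ, ?_, ?_, ?_⟩
      · intro i j
        by_cases h : i = j <;> simp [Matrix.one_apply, h]
      · simp only [Matrix.submatrix_apply, s0]
        exact (z 2 (by decide) (by decide)).1
      · simp only [Matrix.submatrix_apply, s0]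
        exact (z 3 (by decide) (by decide)).1
      · simp only [Matrix.submatrix_apply, s1]
        exact (z 3 (by decide) (by decide)).2
  · push Not at hN
    by_cases h3 : ∃ k, ∀ l, l ≠ k → A k l = 0
    · obtain ⟨k, hk⟩ := h3
      apply good_perm A (Equiv.swap 0 k)
      have h0 : ∀ l, l ≠ 0 → (A.submatrix (Equiv.swap 0 k) (Equiv.swap 0 k)) 0 l = 0 := by
        intro l hl
        simp only [Matrix.submatrix_apply, Equiv.swap_apply_left]
        apply hk
        intro h
        apply hl
        have h' : Equiv.swap 0 k l = Equiv.swap 0 k 0 := by rw [h]; simp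
        exact (Equiv.swap 0 k).injective h'
      refine case31 _ (hAp _) ?_ h0
      have key : ∀ S : Finset (Fin 4), (∀ l, l ∉ S → ∀ j ∈ S,
          (A.submatrix (Equiv.swap 0 k) (Equiv.swap 0 k)) l j = 0) →
          S.card ≠ 1 ∧ S.card ≠ 2 := by
        intro S hS
        have := hN _ (inv_perm A _ S hS)
        rwa [Finset.card_map] at this
      intro S hS
      have k1 := key S hS
      have k2 := key (S.erase 0) (by
        intro l hl j hj
        rw [Finset.mem_erase] at hj
        by_cases h : l = 0
        · rw [h]; exact h0 j hj.1
        · refine hS l ?_ j hj.2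
          intro h'
          exact hl (Finset.mem_erase.2 ⟨h, h'⟩))
      clear hS key
      revert S
      decide
    · apply irr_case A hA
      intro S hS
      have k1 := hN S hS
      have k2 : ∀ k, S ≠ {k}ᶜ := by
        intro k h
        apply h3
        refine ⟨k, fun l hl => hS k ?_ l ?_⟩
        · simp [h]
        · simp [h, hl]
      clear hS
      revert S
      decide

/-- Every 4×4 Metzler matrix is similar, via a nonnegative invertible
matrix, to a Metzler upper Hessenberg matrix. -/
theorem metzler_4x4_similar_metzler_hessenberg
    (A : Matrix (Fin 4) (Fin 4) ℝ) (hA : ∀ i j, i ≠ j → 0 ≤ A i j) :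
    ∃ T : Matrix (Fin 4) (Fin 4) ℝ, (∀ i j, 0 ≤ T i j) ∧ T.det ≠ 0 ∧
      (∀ i j, i ≠ j → 0 ≤ (T⁻¹ * A * T) i j) ∧
      (∀ i j : Fin 4, (j : ℕ) + 1 < (i : ℕ) → (T⁻¹ * A * T) i j = 0) := by
  obtain ⟨T, H, hT, hd, he, hH, h20, h30, h31⟩ := good_all A hA
  have h : T⁻¹ * A * T = H := by
    rw [Matrix.mul_assoc, he, ← Matrix.mul_assoc, Matrix.nonsing_inv_mul _ hd.isUnit,
      Matrix.one_mul]
  refine ⟨T, hT, hd, ?_, ?_⟩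
  · rw [h]; exact hH
  · rw [h]
    intro i j hij
    fin_cases i <;> fin_cases j <;> simp at hij ⊢ <;> assumption
end

section
/- Let A be an n×n real diagonalizable matrix with eigenvector matrix V (so V⁻¹AV is diagonal), and let b ∈ ℝⁿ be such that all entries of V⁻¹e₁ and of V⁻¹b are nonzero. Then there exists an invertible real matrix T such that T⁻¹AT = A and T⁻¹b = e₁. -/
open Matrix

/-- If `A` is diagonalizable with eigenvector matrix `V` (so `V⁻¹ A V` is
diagonal), and all entries of `V⁻¹ e₁` and of `V⁻¹ b` are nonzero, then there is an
invertible `T` with `T⁻¹ A T = A` and `T⁻¹ b = e₁`. -/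
theorem exists_similarity_fixing_A_sending_b_to_e1
    {n : ℕ} [NeZero n] (A V : Matrix (Fin n) (Fin n) ℝ) (b : Fin n → ℝ)
    (hV : V.det ≠ 0) (hdiag : (V⁻¹ * A * V).IsDiag)
    (he1 : ∀ i, (V⁻¹.mulVec (Pi.single 0 1 : Fin n → ℝ)) i ≠ 0)
    (hb : ∀ i, (V⁻¹.mulVec b) i ≠ 0) :
    ∃ T : Matrix (Fin n) (Fin n) ℝ, T.det ≠ 0 ∧ T⁻¹ * A * T = A ∧
      T⁻¹.mulVec b = (Pi.single 0 1 : Fin n → ℝ) := by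
  set e : Fin n → ℝ := Pi.single 0 1 with he
  have hVu : IsUnit V.det := isUnit_iff_ne_zero.mpr hV
  have h1 : V * V⁻¹ = 1 := Matrix.mul_nonsing_inv V hVu
  have h2 : V⁻¹ * V = 1 := Matrix.nonsing_inv_mul V hVu
  obtain ⟨d, hd⟩ : ∃ d, V⁻¹ * A * V = diagonal d := ⟨_, hdiag.diagonal_diag.symm⟩
  have hA : A = V * diagonal d * V⁻¹ := by
    rw [← hd]
    calc A = (V * V⁻¹) * A * (V * V⁻¹) := by rw [h1]; simp
      _ = _ := by simp only [Matrix.mul_assoc]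
  set c : Fin n → ℝ := fun i => (V⁻¹ *ᵥ b) i / (V⁻¹ *ᵥ e) i with hc
  have hTdet : (V * diagonal c * V⁻¹).det ≠ 0 := by
    rw [det_mul, det_mul, det_diagonal]
    refine mul_ne_zero (mul_ne_zero hV ?_) ?_
    · exact Finset.prod_ne_zero_iff.mpr fun i _ => div_ne_zero (hb i) (he1 i)
    · intro h
      have := congrArg det h2
      rw [det_mul, h] at this
      simp at this
  have hTu : IsUnit (V * diagonal c * V⁻¹).det := isUnit_iff_ne_zero.mpr hTdet
  have hcomm : A * (V * diagonal c * V⁻¹) = (V * diagonal c * V⁻¹) * A := by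
    have key : ∀ x y : Fin n → ℝ, (V * diagonal x * V⁻¹) * (V * diagonal y * V⁻¹)
        = V * diagonal (fun i => x i * y i) * V⁻¹ := by
      intro x y
      calc _ = V * diagonal x * (V⁻¹ * V) * diagonal y * V⁻¹ := by
            simp only [Matrix.mul_assoc]
        _ = _ := by rw [h2, Matrix.mul_one, Matrix.mul_assoc V, diagonal_mul_diagonal]
    rw [hA, key, key]
    simp only [mul_comm]
  have hTe : (V * diagonal c * V⁻¹) *ᵥ e = b := by
    have h3 : diagonal c *ᵥ (V⁻¹ *ᵥ e) = V⁻¹ *ᵥ b := by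
      ext i
      rw [mulVec_diagonal]
      exact div_mul_cancel₀ _ (he1 i)
    rw [← mulVec_mulVec, ← mulVec_mulVec, h3, mulVec_mulVec, h1, one_mulVec]
  refine ⟨V * diagonal c * V⁻¹, hTdet, ?_, ?_⟩
  · rw [Matrix.mul_assoc, hcomm, ← Matrix.mul_assoc, Matrix.nonsing_inv_mul _ hTu,
      Matrix.one_mul]
  · conv_lhs => rw [← hTe]
    rw [mulVec_mulVec, Matrix.nonsing_inv_mul _ hTu, one_mulVec]
end
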